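/- Let I = [T0,T], let g = (g_1,…,g_m) : I × ℝⁿ → ℝ^m with C(t) := {x ∈ ℝⁿ : g_k(t,x) ≤ 0 for all k = 1,…,m} nonempty and closed for each t ∈ I. Assume: (i) the hypotheses of the prox-regularity theorem hold, i.e. there exist ρ ∈ (0,∞], γ > 0 and δ > 0 such that each g_k(t,·) is continuously differentiable on U_ρ(C(t)) := {y : d_{C(t)}(y) < ρ}, each ∇g_k(t,·) is γ-hypomonotone on U_ρ(C(t)) (⟨∇g_k(t,·)(x) − ∇g_k(t,·)(y), x − y⟩ ≥ −γ‖x−y‖² there), and for every (t,x) with x in the boundary of C(t) there is v̄ in the closed unit ball with ⟨∇g_k(t,·)(x), v̄⟩ ≤ −δ for all k (so each C(t) is r-prox-regular with r = min{ρ, δ/γ}); (ii) there exist an absolutely continuous function w : I → ℝ, a real δ' > 0 and a unit vector y ∈ ℝⁿ such that g_i(t,x) ≤ g_i(s,x) + |w(t) − w(s)| for all x ∈ U_r(C(s)) and ⟨∇g_i(t,·)(x), y⟩ ≤ −δ' for all t ∈ I, x ∈ U_r(C(t)), i = 1,…,m; (iii) f1 : I × ℝⁿ → ℝⁿ and f2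 : Q_Δ × ℝⁿ → ℝⁿ satisfy hypotheses (H2) and (H3). Then for every initial point x0 ∈ ℝⁿ with g(T0, x0) ≤ 0 componentwise, the nonlinear integro-differential complementarity system has one and only one solution x; that is, there is a unique absolutely continuous x : I → ℝⁿ with x(T0) = x0 and g(t, x(t)) ≤ 0 componentwise for all t ∈ I, for which there exists z : I → ℝ₊^m such that, for almost every t ∈ I, −x'(t) = f1(t,x(t)) + ∫_{T0}^t f2(t,s,x(s)) ds + (∇g(t,·)(x(t)))^T z(t) and z_k(t)·g_k(t,x(t)) = 0 for all k = 1,…,m. -/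

import Mathlib

open MeasureTheory Set
open scoped RealInnerProductSpace ENNReal Pointwise NNReal

noncomputable section

variable {H : Type*} [NormedAddCommGroup H] [InnerProductSpace ℝ H]

/-- The proximal normal cone of `S` at `x`. -/
def proxNormalCone (S : Set H) (x : H) : Set H :=
  {v | ∃ σ : ℝ, 0 ≤ σ ∧ ∃ δ : ℝ, 0 < δ ∧
    ∀ y ∈ S ∩ Metric.ball x δ, ⟪v, y - x⟫ ≤ σ * ‖y - x‖ ^ 2}

/-- Uniform `r`-prox-regularity, `r ∈ (0, ∞]`. -/
def IsProxRegular (r : ℝ≥0∞) (S : Set H) : Prop :=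
  ∀ x ∈ S, ∀ v ∈ proxNormalCone S x, v ≠ 0 →
    ∀ y ∈ S, ⟪‖v‖⁻¹ • v, y - x⟫ ≤ ((2 * r)⁻¹).toReal * ‖y - x‖ ^ 2

variable [CompleteSpace H]

/-- Solution of the nonlinear integro-differential complementarity system. -/
def IsNIDCSSol {n m : ℕ} (T0 T : ℝ) (g : Fin m → ℝ → EuclideanSpace ℝ (Fin n) → ℝ)
    (f1 : ℝ → EuclideanSpace ℝ (Fin n) → EuclideanSpace ℝ (Fin n))
    (f2 : ℝ → ℝ → EuclideanSpace ℝ (Fin n) → EuclideanSpace ℝ (Fin n))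
    (x x' : ℝ → EuclideanSpace ℝ (Fin n)) : Prop :=
  IntervalIntegrable x' volume T0 T ∧
  (∀ t ∈ Icc T0 T, x t = x T0 + ∫ s in T0..t, x' s) ∧
  (∀ t ∈ Icc T0 T, ∀ k : Fin m, g k t (x t) ≤ 0) ∧
  ∃ z : ℝ → Fin m → ℝ,
    (∀ t ∈ Icc T0 T, ∀ k : Fin m, 0 ≤ z t k) ∧
    (∀ᵐ t ∂volume, t ∈ Icc T0 T →
      (-x' t = f1 t (x t) + (∫ s in T0..t, f2 t s (x s)) +
        ∑ k : Fin m, z t k • gradient (g k t) (x t)) ∧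
      ∀ k : Fin m, z t k * g k t (x t) = 0)

section ACTools
open Filter Topology

/-- A function whose increments are dominated by those of an absolutely continuous function. -/
lemma ac_of_dist_le {X Y : Type*} [PseudoMetricSpace X] [PseudoMetricSpace Y]
    {u : ℝ → X} {v : ℝ → Y} {a b K : ℝ}
    (hv : AbsolutelyContinuousOnInterval v a b)
    (h : ∀ s ∈ uIcc a b, ∀ t ∈ uIcc a b, dist (u s) (u t) ≤ K * dist (v s) (v t)) :
    AbsolutelyContinuousOnInterval u a b := by
  unfold AbsolutelyContinuousOnInterval at hv ⊢
  have hv' := hv.const_mul K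
  rw [mul_zero] at hv'
  refine squeeze_zero' (Eventually.of_forall fun E => Finset.sum_nonneg fun i _ => dist_nonneg) ?_ hv'
  refine Filter.eventually_inf_principal.2 (Eventually.of_forall fun E hE => ?_)
  rw [Finset.mul_sum]
  refine Finset.sum_le_sum fun i hi => h _ (hE.1 i hi).1 _ (hE.1 i hi).2

lemma ac_exp {a : ℝ → ℝ} {p q : ℝ} (ha : AbsolutelyContinuousOnInterval a p q) :
    AbsolutelyContinuousOnInterval (fun t => Real.exp (a t)) p q := by
  obtain ⟨C, hC⟩ := ha.exists_bound
  have key : ∀ x y : ℝ, x ≤ C → y ≤ C → x ≤ y → Real.exp y - Real.exp x ≤ Real.exp C * (y - x) := by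
    intro x y hx hy hxy
    have h1 : Real.exp x = Real.exp y * Real.exp (x - y) := by rw [← Real.exp_add]; ring_nf
    have h2 := Real.add_one_le_exp (x - y)
    have h3 := Real.exp_le_exp.2 hy
    have h4 := Real.exp_pos y
    nlinarith
  refine ac_of_dist_le (K := Real.exp C) ha ?_
  intro s hs t ht
  have h1 := (le_abs_self _).trans (hC s hs)
  have h2 := (le_abs_self _).trans (hC t ht)
  rw [Real.dist_eq, Real.dist_eq]
  rcases le_total (a s) (a t) with h | h
  · rw [abs_of_nonpos (by simpa using h), abs_of_nonpos (by simpa using h)]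
    simpa using key _ _ h1 h2 h
  · rw [abs_of_nonneg (by simpa using h), abs_of_nonneg (by simpa using h)]
    simpa using key _ _ h2 h1 h

lemma ii_mono {F : Type*} [NormedAddCommGroup F] {f : ℝ → F} {a b s t : ℝ}
    (hf : IntervalIntegrable f volume a b) (hs : s ∈ Icc a b) (ht : t ∈ Icc a b) :
    IntervalIntegrable f volume s t := by
  refine hf.mono_set ?_
  have hab := hs.1.trans hs.2
  rw [uIcc_of_le hab]
  intro r hr
  exact ⟨(le_inf hs.1 ht.1).trans hr.1, hr.2.trans (sup_le hs.2 ht.2)⟩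

lemma ae_prop_restrict {a b s t : ℝ} {P : ℝ → Prop} (hs : s ∈ Icc a b) (ht : t ∈ Icc a b)
    (h : ∀ᵐ x : ℝ, x ∈ Icc a b → P x) : ∀ᵐ x : ℝ, x ∈ Icc s t → P x := by
  filter_upwards [h] with x hx hxs
  exact hx ⟨hs.1.trans hxs.1, hxs.2.trans ht.2⟩

/-- Monotonicity of interval integrals, a.e. version on `Icc`. -/
lemma integral_mono_ae' {f g : ℝ → ℝ} {a b : ℝ} (hab : a ≤ b)
    (hf : IntervalIntegrable f volume a b) (hg : IntervalIntegrable g volume a b)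
    (h : ∀ᵐ x : ℝ, x ∈ Icc a b → f x ≤ g x) :
    ∫ x in a..b, f x ≤ ∫ x in a..b, g x := by
  refine intervalIntegral.integral_mono_ae_restrict hab hf hg ?_
  rw [Filter.EventuallyLE, ae_restrict_iff' measurableSet_Icc]
  exact h

variable {F : Type*} [NormedAddCommGroup F] [NormedSpace ℝ F] [CompleteSpace F]

lemma dist_le_of_integral {x x' : ℝ → F} {a b : ℝ}
    (hx' : IntervalIntegrable x' volume a b)
    (hx : ∀ t ∈ Icc a b, x t = x a + ∫ s in a..t, x' s) {s t : ℝ}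
    (hs : s ∈ Icc a b) (ht : t ∈ Icc a b) (hst : s ≤ t) :
    dist (x s) (x t) ≤ ∫ r in s..t, ‖x' r‖ := by
  have ha : a ∈ Icc a b := ⟨le_rfl, hs.1.trans hs.2⟩
  have : x t - x s = ∫ r in s..t, x' r := by
    rw [hx t ht, hx s hs, add_sub_add_left_eq_sub,
      intervalIntegral.integral_interval_sub_left (ii_mono hx' ha ht) (ii_mono hx' ha hs)]
  rw [dist_comm, dist_eq_norm, this]
  exact intervalIntegral.norm_integral_le_integral_norm hst

lemma ac_of_integral {x x' : ℝ → F} {a b : ℝ} (hab : a ≤ b)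
    (hx' : IntervalIntegrable x' volume a b)
    (hx : ∀ t ∈ Icc a b, x t = x a + ∫ s in a..t, x' s) :
    AbsolutelyContinuousOnInterval x a b := by
  have hn := hx'.norm
  have ha : a ∈ Icc a b := ⟨le_rfl, hab⟩
  refine ac_of_dist_le (K := 1) (hn.absolutelyContinuousOnInterval_intervalIntegral (c := a) (by simp)) ?_
  rw [uIcc_of_le hab]
  have key : ∀ s ∈ Icc a b, ∀ t ∈ Icc a b, s ≤ t → dist (x s) (x t) ≤
      dist (∫ v in a..s, ‖x' v‖) (∫ v in a..t, ‖x' v‖) := by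
    intro s hs t ht hst
    refine (dist_le_of_integral hx' hx hs ht hst).trans ?_
    rw [dist_comm, Real.dist_eq,
      intervalIntegral.integral_interval_sub_left (ii_mono hn ha ht) (ii_mono hn ha hs)]
    exact le_abs_self _
  intro s hs t ht
  rw [one_mul]
  rcases le_total s t with h | h
  · exact key s hs t ht h
  · rw [dist_comm (x s), dist_comm (∫ v in a..s, ‖x' v‖)]; exact key t ht s hs h

lemma ae_hasDerivAt_of_integral {x x' : ℝ → F} {a b : ℝ} (hab : a ≤ b)
    (hx' : IntervalIntegrable x' volume a b)
    (hx : ∀ t ∈ Icc a b, x t = x a + ∫ s in a..t, x' s) :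
    ∀ᵐ t : ℝ, t ∈ Icc a b → HasDerivAt x (x' t) t := by
  have h₁ : ∀ᵐ x : ℝ, x ≠ a := by simp [ae_iff, measure_singleton]
  have h₂ : ∀ᵐ x : ℝ, x ≠ b := by simp [ae_iff, measure_singleton]
  filter_upwards [hx'.ae_hasDerivAt_integral, h₁, h₂] with t ht hta htb hmem
  rw [uIcc_of_le hab] at ht
  have h := (ht hmem a ⟨le_rfl, hab⟩).const_add (x a)
  refine h.congr_of_eventuallyEq ?_
  filter_upwards [Icc_mem_nhds (lt_of_le_of_ne hmem.1 (Ne.symm hta)) (lt_of_le_of_ne hmem.2 htb)] with s hs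
  exact hx s hs

/-- Grönwall. -/
lemma gronwall_ac {φ A b : ℝ → ℝ} {p q : ℝ} (hpq : p ≤ q)
    (hφ : AbsolutelyContinuousOnInterval φ p q) (hφ0 : φ p = 0) (hφnn : ∀ t, 0 ≤ φ t)
    (hA : IntervalIntegrable A volume p q) (hb : IntervalIntegrable b volume p q)
    (hAnn : ∀ t ∈ Icc p q, 0 ≤ A t) (hbnn : ∀ t ∈ Icc p q, 0 ≤ b t)
    (h : ∀ᵐ t : ℝ, t ∈ Icc p q → ∀ d, HasDerivAt φ d t → d ≤ A t * φ t + b t) :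
    ∀ t ∈ Icc p q, φ t ≤ Real.exp (∫ s in p..q, A s) * ∫ s in p..t, b s := by
  intro t ht
  have hp : p ∈ Icc p q := ⟨le_rfl, hpq⟩
  have hq : q ∈ Icc p q := ⟨hpq, le_rfl⟩
  set I : ℝ → ℝ := fun t => ∫ s in p..t, A s with hI
  have hIac : AbsolutelyContinuousOnInterval I p q :=
    hA.absolutelyContinuousOnInterval_intervalIntegral (c := p) (by simp)
  have hG : AbsolutelyContinuousOnInterval (fun t => Real.exp (-I t)) p q := ac_exp hIac.fun_neg
  have hF := hG.fun_mul hφ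
  have hsub : uIcc p t ⊆ uIcc p q := by
    rw [uIcc_of_le hpq, uIcc_of_le ht.1]; exact Icc_subset_Icc_right ht.2
  have hInn : ∀ s ∈ Icc p q, 0 ≤ I s := fun s hs =>
    intervalIntegral.integral_nonneg hs.1 fun r hr => hAnn r ⟨hr.1, hr.2.trans hs.2⟩
  have e := (hF.mono hsub).integral_deriv_eq_sub
  have hle : ∫ s in p..t, deriv (fun t => Real.exp (-I t) * φ t) s ≤ ∫ s in p..t, b s := by
    refine integral_mono_ae' ht.1 (hF.mono hsub).intervalIntegrable_deriv (ii_mono hb hp ht) ?_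
    have h1 := hφ.ae_differentiableAt
    have h2 := hA.ae_hasDerivAt_integral
    rw [uIcc_of_le hpq] at h1 h2
    refine ae_prop_restrict hp ht ?_
    filter_upwards [h1, h2, h] with s hs1 hs2 hs3 hs
    have d1 := (hs1 hs).hasDerivAt
    have d2 := hs2 hs p hp
    have d3 := (d2.neg.exp).mul d1
    have d4 : deriv (fun t => Real.exp (-I t) * φ t) s = _ := d3.deriv
    rw [d4]
    have h4 := hs3 hs _ d1
    have h5 : Real.exp (-I s) ≤ 1 := Real.exp_le_one_iff.2 (by linarith [hInn s hs])
    have h6 : 0 < Real.exp (-I s) := Real.exp_pos _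
    have h7 := hbnn s hs
    calc _ = Real.exp (-I s) * (deriv φ s - A s * φ s) := by simp only [hI, Pi.neg_apply]; ring
      _ ≤ Real.exp (-I s) * b s := by gcongr; linarith
      _ ≤ 1 * b s := by gcongr
      _ = b s := one_mul _
  rw [e, hφ0, mul_zero, sub_zero] at hle
  have hIle : I t ≤ I q := by
    rw [← sub_nonneg, hI]
    simp only
    rw [intervalIntegral.integral_interval_sub_left (ii_mono hA hp hq) (ii_mono hA hp ht)]
    exact intervalIntegral.integral_nonneg ht.2 fun r hr => hAnn r ⟨ht.1.trans hr.1, hr.2⟩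
  have hbint : 0 ≤ ∫ s in p..t, b s :=
    intervalIntegral.integral_nonneg ht.1 fun r hr => hbnn r ⟨hr.1, hr.2.trans ht.2⟩
  calc φ t = Real.exp (I t) * (Real.exp (-I t) * φ t) := by
        rw [← mul_assoc, ← Real.exp_add]; simp
    _ ≤ Real.exp (I t) * ∫ s in p..t, b s := by gcongr
    _ ≤ Real.exp (I q) * ∫ s in p..t, b s := by gcongr

/-- `∫ ℓ exp (lam Λ) ≤ exp (lam Λ) / lam`, where Λ is a primitive of ℓ. -/
lemma integral_exp_le {l : ℝ → ℝ} {p q lam : ℝ} (hlam : 0 < lam) (hpq : p ≤ q)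
    (hl : IntervalIntegrable l volume p q) {t : ℝ} (ht : t ∈ Icc p q) :
    IntervalIntegrable (fun s => l s * Real.exp (lam * ∫ r in p..s, l r)) volume p t ∧
    ∫ s in p..t, l s * Real.exp (lam * ∫ r in p..s, l r) ≤
      Real.exp (lam * ∫ r in p..t, l r) / lam := by
  have hp : p ∈ Icc p q := ⟨le_rfl, hpq⟩
  have hl' := ii_mono hl hp ht
  have hLac : AbsolutelyContinuousOnInterval (fun s => ∫ r in p..s, l r) p t :=
    hl'.absolutelyContinuousOnInterval_intervalIntegral (c := p) (by simp)
  have hE := ac_exp (hLac.const_mul lam)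
  have e := hE.integral_deriv_eq_sub
  refine ⟨hl'.mul_continuousOn hE.continuousOn, ?_⟩
  have h2 := hl'.ae_hasDerivAt_integral
  have : ∫ s in p..t, deriv (fun t => Real.exp (lam * ∫ r in p..t, l r)) s =
      ∫ s in p..t, lam * (l s * Real.exp (lam * ∫ r in p..s, l r)) := by
    refine intervalIntegral.integral_congr_ae ?_
    filter_upwards [h2] with s hs hs'
    have d := (((hs (uIoc_subset_uIcc hs') p (by simp)).const_mul lam).exp).deriv
    rw [d]; ring
  rw [this, intervalIntegral.integral_const_mul] at e
  rw [le_div_iff₀ hlam, mul_comm, e]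
  simp

end ACTools

section Comparison
variable {F : Type*} [NormedAddCommGroup F] [InnerProductSpace ℝ F] [CompleteSpace F]

/-- Comparison of two solutions of perturbed sweeping processes. -/
lemma sweeping_comparison {p q : ℝ} (hpq : p ≤ q) {x x' y y' h k : ℝ → F} {A B : ℝ → ℝ}
    (hx' : IntervalIntegrable x' volume p q)
    (hx : ∀ t ∈ Icc p q, x t = x p + ∫ s in p..t, x' s)
    (hy' : IntervalIntegrable y' volume p q)
    (hy : ∀ t ∈ Icc p q, y t = y p + ∫ s in p..t, y' s)
    (hxy : x p = y p)
    (hh : IntervalIntegrable h volume p q) (hk : IntervalIntegrable k volume p q)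
    (hA : IntervalIntegrable A volume p q) (hB : IntervalIntegrable B volume p q)
    (hAnn : ∀ t ∈ Icc p q, 0 ≤ A t) (hBnn : ∀ t ∈ Icc p q, 0 ≤ B t)
    (h1 : ∀ᵐ t : ℝ, t ∈ Icc p q → ⟪-x' t - h t, y t - x t⟫ ≤ A t * ‖y t - x t‖ ^ 2)
    (h2 : ∀ᵐ t : ℝ, t ∈ Icc p q → ⟪-y' t - k t, x t - y t⟫ ≤ B t * ‖x t - y t‖ ^ 2) :
    ∀ t ∈ Icc p q, ‖x t - y t‖ ≤
      Real.exp (∫ s in p..q, (A s + B s)) * ∫ s in p..t, ‖h s - k s‖ := by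
  have hac := (ac_of_integral hpq hx' hx).fun_sub (ac_of_integral hpq hy' hy)
  have hn : AbsolutelyContinuousOnInterval (fun t => ‖x t - y t‖) p q := by
    refine ac_of_dist_le (K := 1) hac fun s _ t _ => ?_
    rw [one_mul]
    rw [Real.dist_eq, dist_eq_norm]
    exact abs_norm_sub_norm_le _ _
  refine gronwall_ac hpq hn (by simp [hxy]) (fun t => norm_nonneg _) (hA.add hB) (hh.sub hk).norm
    (fun t ht => add_nonneg (hAnn t ht) (hBnn t ht)) (fun t _ => norm_nonneg _) ?_
  filter_upwards [h1, h2, ae_hasDerivAt_of_integral hpq hx' hx,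
    ae_hasDerivAt_of_integral hpq hy' hy] with t t1 t2 t3 t4 ht d hd
  by_cases h0 : x t - y t = 0
  · have hmin : IsLocalMin (fun t => ‖x t - y t‖) t :=
      Filter.Eventually.of_forall fun s => by simp [h0]
    rw [hmin.hasDerivAt_eq_zero hd, h0]
    simp
  · have hpos : 0 < ‖x t - y t‖ := norm_pos_iff.2 h0
    have d1 := ((t3 ht).sub (t4 ht)).norm_sq
    have d2 := hd.pow 2
    have e := d1.unique d2
    have e' : ‖x t - y t‖ * d = ⟪x t - y t, x' t - y' t⟫ := by
      simp only [Pi.sub_apply] at e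
      norm_num at e
      linarith
    have i1 := t1 ht
    have i2 := t2 ht
    have i3 : ⟪-(h t - k t), x t - y t⟫ ≤ ‖h t - k t‖ * ‖x t - y t‖ := by
      refine (real_inner_le_norm _ _).trans ?_
      rw [norm_neg]
    have i4 : ⟪x t - y t, x' t - y' t⟫ = ⟪-x' t - h t, y t - x t⟫ + ⟪-y' t - k t, x t - y t⟫
        + ⟪-(h t - k t), x t - y t⟫ := by
      simp only [inner_sub_left, inner_sub_right, inner_neg_left, real_inner_comm]
      simp only [real_inner_comm (x t), real_inner_comm (y t)]
      ring
    rw [norm_sub_rev (y t)] at i1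
    have : ‖x t - y t‖ * d ≤ ‖x t - y t‖ * ((A t + B t) * ‖x t - y t‖ + ‖h t - k t‖) := by
      nlinarith
    exact le_of_mul_le_mul_left this hpos
end Comparison

section Sweeping
open Filter Topology
variable {F : Type*} [NormedAddCommGroup F] [InnerProductSpace ℝ F]

/-- The standing assumptions on the moving set for the unperturbed sweeping process. -/
structure SweepHyp (D : ℝ → Set F) (v : ℝ → ℝ) (r K : ℝ) : Prop where
  closed : ∀ t, IsClosed (D t)
  ne : ∀ t, (D t).Nonempty
  mono : Monotone v
  uc : UniformContinuous v
  rpos : 0 < r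
  Knn : 0 ≤ K
  move : ∀ s t, |v t - v s| < r → ∀ x ∈ D s, ∃ x' ∈ D t, ‖x' - x‖ ≤ |v t - v s|
  pr : ∀ t, ∀ x ∈ D t, ∀ ζ : F, ∀ σ : ℝ, (∀ y ∈ D t, ⟪ζ, y - x⟫ ≤ σ * ‖y - x‖ ^ 2) →
    ∀ y ∈ D t, ⟪ζ, y - x⟫ ≤ K * ‖ζ‖ * ‖y - x‖ ^ 2

/-- The discrete catching-up sequence along the times `τ`. -/
structure CatchUp (D : ℝ → Set F) (τ : ℕ → ℝ) (u : ℕ → F) : Prop where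
  mem : ∀ i, u i ∈ D (τ i)
  near : ∀ i, ∀ y ∈ D (τ (i + 1)), ‖u i - u (i + 1)‖ ≤ ‖u i - y‖

lemma exists_catchUp [ProperSpace F] {D : ℝ → Set F} (hcl : ∀ t, IsClosed (D t))
    (hne : ∀ t, (D t).Nonempty) (τ : ℕ → ℝ) {x0 : F} (hx0 : x0 ∈ D (τ 0)) :
    ∃ u : ℕ → F, u 0 = x0 ∧ CatchUp D τ u := by
  have hproj : ∀ (t : ℝ) (x : F), ∃ p ∈ D t, ∀ y ∈ D t, ‖x - p‖ ≤ ‖x - y‖ := by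
    intro t x
    obtain ⟨p, hp, hp'⟩ := (hcl t).exists_infDist_eq_dist (hne t) x
    refine ⟨p, hp, fun y hy => ?_⟩
    rw [← dist_eq_norm, ← dist_eq_norm, ← hp']
    exact Metric.infDist_le_dist_of_mem hy
  choose P hP hP' using hproj
  let u : ℕ → F := fun i => Nat.rec x0 (fun i x => P (τ (i + 1)) x) i
  refine ⟨u, rfl, ?_, ?_⟩
  · intro i
    cases i with
    | zero => exact hx0
    | succ i => exact hP _ _
  · intro i y hy
    exact hP' _ _ y hy

variable {D : ℝ → Set F} {v : ℝ → ℝ} {r K : ℝ} {τ : ℕ → ℝ} {u : ℕ → F}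

lemma CatchUp.step (hu : CatchUp D τ u) (hD : SweepHyp D v r K) (hτ : Monotone τ)
    (hstep : ∀ i, v (τ (i + 1)) - v (τ i) < r) (i : ℕ) :
    ‖u i - u (i + 1)‖ ≤ v (τ (i + 1)) - v (τ i) := by
  have h0 : 0 ≤ v (τ (i + 1)) - v (τ i) := sub_nonneg.2 (hD.mono (hτ (Nat.le_succ i)))
  obtain ⟨y, hy, hy'⟩ := hD.move (τ i) (τ (i + 1)) (by rw [abs_of_nonneg h0]; exact hstep i) _ (hu.mem i)
  rw [abs_of_nonneg h0, norm_sub_rev] at hy'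
  exact (hu.near i y hy).trans hy'

lemma CatchUp.dist_le (hu : CatchUp D τ u) (hD : SweepHyp D v r K) (hτ : Monotone τ)
    (hstep : ∀ i, v (τ (i + 1)) - v (τ i) < r) {a b : ℕ} (hab : a ≤ b) :
    ‖u a - u b‖ ≤ v (τ b) - v (τ a) := by
  induction b, hab using Nat.le_induction with
  | base => simp
  | succ b hb ih =>
    have := norm_sub_le_norm_sub_add_norm_sub (u a) (u b) (u (b + 1))
    have := hu.step hD hτ hstep b
    linarith

lemma CatchUp.key (hu : CatchUp D τ u) (hD : SweepHyp D v r K) (hτ : Monotone τ)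
    (hstep : ∀ i, v (τ (i + 1)) - v (τ i) < r) {a b : ℕ} (hab : a ≤ b) {t Δ : ℝ} {y : F}
    (hy : y ∈ D t) (hΔ : Δ < r) (h1 : ∀ i, a ≤ i → i ≤ b → |v (τ i) - v t| ≤ Δ)
    (h2 : v (τ b) - v (τ a) ≤ Δ) :
    ⟪u a - u b, y - u a⟫ ≤ (v (τ b) - v (τ a)) * (2 * Δ + K * (‖y - u a‖ + 2 * Δ) ^ 2) := by
  have key : ∀ c, a ≤ c → c ≤ b →
      ⟪u a - u c, y - u a⟫ ≤ (v (τ c) - v (τ a)) * (2 * Δ + K * (‖y - u a‖ + 2 * Δ) ^ 2) := by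
    intro c hac
    induction c, hac using Nat.le_induction with
    | base => intro _; simp
    | succ c hc ih =>
      intro hcb
      have ih' := ih (by omega)
      have hs := hu.step hD hτ hstep c
      have hv := h1 (c + 1) (by omega) hcb
      obtain ⟨z, hz, hz'⟩ := hD.move t (τ (c + 1)) (lt_of_le_of_lt hv hΔ) y hy
      have hzy : ‖z - y‖ ≤ Δ := hz'.trans hv
      have hua : ‖u a - u (c + 1)‖ ≤ Δ := by
        refine (hu.dist_le hD hτ hstep (by omega)).trans (le_trans ?_ h2)
        have := hD.mono (hτ hcb)
        linarith
      have hn : ∀ w ∈ D (τ (c + 1)), ⟪u c - u (c + 1), w - u (c + 1)⟫ ≤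
          (1 / 2) * ‖w - u (c + 1)‖ ^ 2 := by
        intro w hw
        have hh := hu.near c w hw
        have e : u c - w = (u c - u (c + 1)) - (w - u (c + 1)) := by abel
        have e2 := @norm_sub_sq_real F _ _ (u c - u (c + 1)) (w - u (c + 1))
        rw [← e] at e2
        have := pow_le_pow_left₀ (norm_nonneg _) hh 2
        linarith
      have hp := hD.pr _ _ (hu.mem (c + 1)) _ _ hn z hz
      have hΔ0 : 0 ≤ Δ := (abs_nonneg _).trans hv
      have e : ⟪u c - u (c + 1), y - u a⟫ = ⟪u c - u (c + 1), z - u (c + 1)⟫ +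
          ⟪u c - u (c + 1), (y - z) + (u (c + 1) - u a)⟫ := by
        rw [← inner_add_right]; congr 1; abel
      have b1 : ⟪u c - u (c + 1), (y - z) + (u (c + 1) - u a)⟫ ≤
          (v (τ (c + 1)) - v (τ c)) * (2 * Δ) := by
        refine (real_inner_le_norm _ _).trans ?_
        have : ‖(y - z) + (u (c + 1) - u a)‖ ≤ 2 * Δ := by
          refine (norm_add_le _ _).trans ?_
          rw [norm_sub_rev y, norm_sub_rev _ (u a)]; linarith
        gcongr
        exact (norm_nonneg _).trans hs
      have b2 : ‖z - u (c + 1)‖ ≤ ‖y - u a‖ + 2 * Δ := by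
        have e3 : z - u (c + 1) = (y - u a) + ((z - y) + (u a - u (c + 1))) := by abel
        rw [e3]
        refine (norm_add_le _ _).trans ?_
        have := norm_add_le (z - y) (u a - u (c + 1))
        linarith
      have b3 : K * ‖u c - u (c + 1)‖ * ‖z - u (c + 1)‖ ^ 2 ≤
          (v (τ (c + 1)) - v (τ c)) * (K * (‖y - u a‖ + 2 * Δ) ^ 2) := by
        have hK := hD.Knn
        calc K * ‖u c - u (c + 1)‖ * ‖z - u (c + 1)‖ ^ 2
            ≤ K * (v (τ (c + 1)) - v (τ c)) * (‖y - u a‖ + 2 * Δ) ^ 2 := by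
              have := (norm_nonneg _).trans hs
              gcongr
          _ = _ := by ring
      have e4 : ⟪u a - u (c + 1), y - u a⟫ = ⟪u a - u c, y - u a⟫ + ⟪u c - u (c + 1), y - u a⟫ := by
        rw [← inner_add_left]; congr 1; abel
      rw [e4, e]
      linarith
  exact key b hab le_rfl

/-- The grid times. -/
def gridTime (T0 : ℝ) (n : ℕ) (i : ℕ) : ℝ := T0 + i * (1 / ((n : ℝ) + 1))

/-- The grid index. -/
def gridIdx (T0 : ℝ) (n : ℕ) (t : ℝ) : ℕ := ⌊(t - T0) * ((n : ℝ) + 1)⌋₊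

lemma gridTime_mono (T0 : ℝ) (n : ℕ) : Monotone (gridTime T0 n) := by
  intro i j hij
  unfold gridTime
  gcongr

lemma gridIdx_mono (T0 : ℝ) (n : ℕ) : Monotone (gridIdx T0 n) := by
  intro s t hst
  unfold gridIdx
  gcongr

lemma gridTime_idx_le {T0 : ℝ} (n : ℕ) {t : ℝ} (ht : T0 ≤ t) :
    gridTime T0 n (gridIdx T0 n t) ≤ t := by
  unfold gridTime gridIdx
  have h0 : 0 ≤ (t - T0) * ((n : ℝ) + 1) := mul_nonneg (by linarith) (by positivity)
  have h := Nat.floor_le h0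
  have hn : (0 : ℝ) < (n : ℝ) + 1 := by positivity
  have : (⌊(t - T0) * ((n : ℝ) + 1)⌋₊ : ℝ) * (1 / ((n : ℝ) + 1)) ≤ t - T0 := by
    rw [mul_one_div, div_le_iff₀ hn]; exact h
  linarith

lemma lt_gridTime_idx {T0 : ℝ} (n : ℕ) {t : ℝ} :
    t - 1 / ((n : ℝ) + 1) < gridTime T0 n (gridIdx T0 n t) := by
  unfold gridTime gridIdx
  have h := Nat.lt_floor_add_one ((t - T0) * ((n : ℝ) + 1))
  have hn : (0 : ℝ) < (n : ℝ) + 1 := by positivity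
  have : t - T0 < ((⌊(t - T0) * ((n : ℝ) + 1)⌋₊ : ℝ) + 1) * (1 / ((n : ℝ) + 1)) := by
    rw [mul_one_div, lt_div_iff₀ hn]; exact h
  rw [add_mul, one_mul] at this
  linarith

lemma gridTime_tendsto {T0 t : ℝ} (ht : T0 ≤ t) :
    Tendsto (fun n => gridTime T0 n (gridIdx T0 n t)) atTop (𝓝 t) := by
  refine tendsto_of_tendsto_of_tendsto_of_le_of_le (g := fun n : ℕ => t - 1 / ((n : ℝ) + 1))
    (h := fun _ => t) ?_ tendsto_const_nhds (fun n => lt_gridTime_idx n |>.le)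
    (fun n => gridTime_idx_le n ht)
  simpa using (tendsto_one_div_add_atTop_nhds_zero_nat (𝕜 := ℝ)).const_sub t

lemma exists_sweep_limit [ProperSpace F] (hD : SweepHyp D v r K) (T0 : ℝ) {x0 : F}
    (hx0 : x0 ∈ D T0) :
    ∃ u : ℝ → F, u T0 = x0 ∧ (∀ t, T0 ≤ t → u t ∈ D t) ∧
      (∀ t s, T0 ≤ t → t ≤ s → ‖u t - u s‖ ≤ v s - v t) ∧
      ∀ t s, T0 ≤ t → t ≤ s → v s - v t < r → ∀ y ∈ D t,
        ⟪u t - u s, y - u t⟫ ≤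
          (v s - v t) * (2 * (v s - v t) + K * (‖y - u t‖ + 2 * (v s - v t)) ^ 2) := by
  have hx0' : ∀ n, x0 ∈ D (gridTime T0 n 0) := fun n => by simpa [gridTime] using hx0
  choose u hu0 hu using fun n => exists_catchUp hD.closed hD.ne (gridTime T0 n) (hx0' n)
  have hsmall : ∀ᶠ n : ℕ in atTop, ∀ i, v (gridTime T0 n (i + 1)) - v (gridTime T0 n i) < r := by
    obtain ⟨η, hη, h⟩ := Metric.uniformContinuous_iff.1 hD.uc r hD.rpos
    filter_upwards [(tendsto_one_div_add_atTop_nhds_zero_nat (𝕜 := ℝ)).eventually_lt_const hη]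
      with n hn i
    have hpos : (0 : ℝ) < 1 / ((n : ℝ) + 1) := by positivity
    have e : gridTime T0 n (i + 1) - gridTime T0 n i = 1 / ((n : ℝ) + 1) := by
      unfold gridTime; push_cast; ring
    have := h (a := gridTime T0 n (i + 1)) (b := gridTime T0 n i)
      (by rw [Real.dist_eq, e, abs_of_pos hpos]; exact hn)
    exact (le_abs_self _).trans_lt this
  let 𝒰 := hyperfilter ℕ
  have h𝒰 : (𝒰 : Filter ℕ) ≤ atTop := Nat.hyperfilter_le_atTop
  have hsm := hsmall.filter_mono h𝒰
  have hlip : ∀ t s, T0 ≤ t → t ≤ s → ∀ᶠ n in (𝒰 : Filter ℕ),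
      ‖u n (gridIdx T0 n t) - u n (gridIdx T0 n s)‖ ≤
        v (gridTime T0 n (gridIdx T0 n s)) - v (gridTime T0 n (gridIdx T0 n t)) := by
    intro t s ht hts
    filter_upwards [hsm] with n hn
    exact (hu n).dist_le hD (gridTime_mono T0 n) hn (gridIdx_mono T0 n hts)
  have hidx0 : ∀ n, gridIdx T0 n T0 = 0 := fun n => by simp [gridIdx]
  have hvt : ∀ t, T0 ≤ t → Tendsto (fun n => v (gridTime T0 n (gridIdx T0 n t))) 𝒰 (𝓝 (v t)) :=
    fun t ht => (hD.uc.continuous.tendsto t).comp ((gridTime_tendsto ht).mono_left h𝒰)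
  have hex : ∀ t, ∃ p : F, T0 ≤ t → Tendsto (fun n => u n (gridIdx T0 n t)) 𝒰 (𝓝 p) := by
    intro t
    by_cases ht : T0 ≤ t
    swap
    · exact ⟨0, fun h => absurd h ht⟩
    have hb : ∀ᶠ n in (𝒰 : Filter ℕ), u n (gridIdx T0 n t) ∈ Metric.closedBall x0 (v t - v T0) := by
      filter_upwards [hlip T0 t le_rfl ht] with n hn
      rw [hidx0, hu0] at hn
      rw [Metric.mem_closedBall, dist_comm, dist_eq_norm]
      refine hn.trans ?_
      have := hD.mono (gridTime_idx_le n ht)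
      have e : gridTime T0 n 0 = T0 := by simp [gridTime]
      rw [e]
      linarith
    obtain ⟨p, -, hp⟩ := (isCompact_closedBall x0 (v t - v T0)).ultrafilter_le_nhds
      (𝒰.map fun n => u n (gridIdx T0 n t)) (by
        rw [le_principal_iff]; exact hb)
    exact ⟨p, fun _ => hp⟩
  choose U hU using hex
  refine ⟨U, ?_, ?_, ?_, ?_⟩
  · refine tendsto_nhds_unique (hU T0 le_rfl) ?_
    simp only [hidx0, hu0]
    exact tendsto_const_nhds
  · intro t ht
    have hinf : Tendsto (fun n => Metric.infDist (u n (gridIdx T0 n t)) (D t)) 𝒰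
        (𝓝 (Metric.infDist (U t) (D t))) :=
      ((Metric.continuous_infDist_pt (D t)).tendsto _).comp (hU t ht)
    have hz : Metric.infDist (U t) (D t) ≤ 0 := by
      have h0 : Tendsto (fun n => |v t - v (gridTime T0 n (gridIdx T0 n t))|) 𝒰 (𝓝 0) := by
        simpa using ((hvt t ht).const_sub (v t)).abs
      refine le_of_tendsto_of_tendsto hinf h0 ?_
      filter_upwards [h0.eventually_lt_const hD.rpos] with n hn
      obtain ⟨x', hx', hx''⟩ := hD.move _ _ hn _ ((hu n).mem (gridIdx T0 n t))
      refine (Metric.infDist_le_dist_of_mem hx').trans ?_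
      rw [dist_comm, dist_eq_norm]; exact hx''
    exact ((hD.closed t).mem_iff_infDist_zero (hD.ne t)).2
      (le_antisymm hz Metric.infDist_nonneg)
  · intro t s ht hts
    exact le_of_tendsto_of_tendsto ((hU t ht).sub (hU s (ht.trans hts))).norm
      ((hvt s (ht.trans hts)).sub (hvt t ht)) (hlip t s ht hts)
  · intro t s ht hts hr y hy
    have hs := ht.trans hts
    have hvnn : 0 ≤ v s - v t := sub_nonneg.2 (hD.mono hts)
    have main : ∀ Δ, v s - v t < Δ → Δ < r →
        ⟪U t - U s, y - U t⟫ ≤ (v s - v t) * (2 * Δ + K * (‖y - U t‖ + 2 * Δ) ^ 2) := by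
      intro Δ hΔ hΔr
      refine le_of_tendsto_of_tendsto
        (((hU t ht).sub (hU s hs)).inner ((hU t ht).const_sub y))
        (((hvt s hs).sub (hvt t ht)).mul
          (((((hU t ht).const_sub y).norm.add_const (2 * Δ)).pow 2).const_mul K |>.const_add (2 * Δ))) ?_
      have hc : ∀ᶠ n in (𝒰 : Filter ℕ), v t - (Δ - (v s - v t)) <
          v (gridTime T0 n (gridIdx T0 n t)) :=
        (hvt t ht).eventually_const_lt (by linarith)
      filter_upwards [hsm, hc] with n hn hcn
      have hss := hD.mono (gridTime_idx_le n hs)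
      refine (hu n).key hD (gridTime_mono T0 n) hn (gridIdx_mono T0 n hts) hy hΔr ?_ ?_
      · intro i hi1 hi2
        have m1 := hD.mono (gridTime_mono T0 n hi1)
        have m2 := hD.mono (gridTime_mono T0 n hi2)
        rw [abs_le]
        constructor <;> linarith
      · linarith
    have hcont : Tendsto (fun Δ => (v s - v t) * (2 * Δ + K * (‖y - U t‖ + 2 * Δ) ^ 2))
        (𝓝[>] (v s - v t))
        (𝓝 ((v s - v t) * (2 * (v s - v t) + K * (‖y - U t‖ + 2 * (v s - v t)) ^ 2))) := by
      refine tendsto_nhdsWithin_of_tendsto_nhds (Continuous.tendsto ?_ _)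
      fun_prop
    refine ge_of_tendsto hcont ?_
    filter_upwards [Ioo_mem_nhdsGT hr] with Δ hΔ
    exact main Δ hΔ.1 hΔ.2

/-- An absolutely continuous curve in Euclidean space is the integral of its derivative. -/
lemma ac_vector {n : ℕ} {u : ℝ → EuclideanSpace ℝ (Fin n)} {a b : ℝ} (hab : a ≤ b)
    (hu : AbsolutelyContinuousOnInterval u a b) :
    ∃ u' : ℝ → EuclideanSpace ℝ (Fin n), IntervalIntegrable u' volume a b ∧
      ∀ t ∈ Icc a b, u t = u a + ∫ s in a..t, u' s := by
  have hi : ∀ i, AbsolutelyContinuousOnInterval (fun t => u t i) a b := by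
    intro i
    refine ac_of_dist_le (K := 1) hu fun s _ t _ => ?_
    rw [one_mul, Real.dist_eq, dist_eq_norm]
    exact PiLp.norm_apply_le (u s - u t) i
  have hdi : ∀ i, IntervalIntegrable (deriv fun t => u t i) volume a b := fun i =>
    (hi i).intervalIntegrable_deriv
  have hdi' : IntervalIntegrable
      (fun s => (WithLp.toLp 2 (fun i => deriv (fun t => u t i) s) : EuclideanSpace ℝ (Fin n)))
      volume a b := by
    have : (fun s => (WithLp.toLp 2 (fun i => deriv (fun t => u t i) s) : EuclideanSpace ℝ (Fin n)))
      = fun s => ∑ i, (deriv (fun t => u t i) s) • (EuclideanSpace.single i (1 : ℝ)) := by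
      funext s
      ext j
      simp [Finset.sum_apply, Pi.single_apply]
    rw [this]
    constructor
    · exact integrable_finsetSum _ fun i _ => (hdi i).1.smul_const _
    · exact integrable_finsetSum _ fun i _ => (hdi i).2.smul_const _
  refine ⟨_, hdi', fun t ht => ?_⟩
  ext i
  have hsub : uIcc a t ⊆ uIcc a b := by
    rw [uIcc_of_le hab, uIcc_of_le ht.1]; exact Icc_subset_Icc_right ht.2
  have e := ((hi i).mono hsub).integral_deriv_eq_sub
  have e2 := (EuclideanSpace.proj (𝕜 := ℝ) i).intervalIntegral_comp_comm
    (ii_mono hdi' ⟨le_rfl, hab⟩ ht)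
  have e3 : ∫ x in a..t, deriv (fun t => u t i) x =
    (∫ s in a..t, (WithLp.toLp 2 (fun i => deriv (fun t => u t i) s) : EuclideanSpace ℝ (Fin n))) i := e2
  rw [PiLp.add_apply, ← e3, e]
  ring

/-- Unperturbed sweeping process in Euclidean space. -/
lemma exists_sweep {n : ℕ} {D : ℝ → Set (EuclideanSpace ℝ (Fin n))} {v w : ℝ → ℝ} {r K T0 T : ℝ}
    (hD : SweepHyp D v r K) (hT : T0 ≤ T) {x0 : EuclideanSpace ℝ (Fin n)} (hx0 : x0 ∈ D T0)
    (hw : IntervalIntegrable w volume T0 T)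
    (hv : ∀ t ∈ Icc T0 T, v t = ∫ s in T0..t, w s) :
    ∃ u u' : ℝ → EuclideanSpace ℝ (Fin n), u T0 = x0 ∧ IntervalIntegrable u' volume T0 T ∧
      (∀ t ∈ Icc T0 T, u t = u T0 + ∫ s in T0..t, u' s) ∧
      (∀ t ∈ Icc T0 T, u t ∈ D t) ∧
      ∀ᵐ t : ℝ, t ∈ Icc T0 T → ‖u' t‖ ≤ w t ∧
        ∀ y ∈ D t, ⟪-u' t, y - u t⟫ ≤ K * w t * ‖y - u t‖ ^ 2 := by
  obtain ⟨u, hu0, humem, hulip, hukey⟩ := exists_sweep_limit hD T0 hx0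
  have hv0 : v T0 = 0 := by rw [hv T0 ⟨le_rfl, hT⟩]; simp
  have hv' : ∀ t ∈ Icc T0 T, v t = v T0 + ∫ s in T0..t, w s := by
    intro t ht; rw [hv0, zero_add]; exact hv t ht
  have hvac := ac_of_integral hT hw hv'
  have huac : AbsolutelyContinuousOnInterval u T0 T := by
    refine ac_of_dist_le (K := 1) hvac ?_
    rw [uIcc_of_le hT]
    intro s hs t ht
    rw [one_mul]
    rcases le_total s t with h | h
    · rw [dist_eq_norm, dist_comm, Real.dist_eq]
      exact (hulip s t hs.1 h).trans (le_abs_self _)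
    · rw [dist_comm, dist_eq_norm, Real.dist_eq]
      exact (hulip t s ht.1 h).trans (le_abs_self _)
  obtain ⟨u', hu'int, hu'⟩ := ac_vector hT huac
  refine ⟨u, u', hu0, hu'int, hu', fun t ht => humem t ht.1, ?_⟩
  filter_upwards [ae_hasDerivAt_of_integral hT hu'int hu', ae_hasDerivAt_of_integral hT hw hv']
    with t h1 h2 ht
  have d1 := (h1 ht).tendsto_slope.mono_left (nhdsGT_le_nhdsNE t)
  have d2 := (h2 ht).tendsto_slope.mono_left (nhdsGT_le_nhdsNE t)
  constructor
  · refine le_of_tendsto_of_tendsto d1.norm d2 ?_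
    filter_upwards [self_mem_nhdsWithin] with s hs
    have hs : t < s := hs
    rw [slope_def_module, slope_def_field, norm_smul, norm_sub_rev, Real.norm_eq_abs,
      abs_of_pos (inv_pos.2 (sub_pos.2 hs)), div_eq_inv_mul]
    have := inv_pos.2 (sub_pos.2 hs)
    gcongr
    exact hulip t s ht.1 hs.le
  · intro y hy
    have hvc : Tendsto v (𝓝[>] t) (𝓝 (v t)) :=
      (hD.uc.continuous.tendsto t).mono_left nhdsWithin_le_nhds
    have l1 : Tendsto (fun s => ⟪-slope u t s, y - u t⟫) (𝓝[>] t) (𝓝 ⟪-u' t, y - u t⟫) :=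
      d1.neg.inner tendsto_const_nhds
    have hz : Tendsto (fun s => v s - v t) (𝓝[>] t) (𝓝 0) := by
      simpa using hvc.sub_const (v t)
    have l2 : Tendsto (fun s => slope v t s * (2 * (v s - v t) + K * (‖y - u t‖ + 2 * (v s - v t)) ^ 2))
        (𝓝[>] t) (𝓝 (w t * (2 * 0 + K * (‖y - u t‖ + 2 * 0) ^ 2))) :=
      d2.mul ((hz.const_mul 2).add ((((hz.const_mul 2).const_add ‖y - u t‖).pow 2).const_mul K))
    have l3 : w t * (2 * 0 + K * (‖y - u t‖ + 2 * 0) ^ 2) = K * w t * ‖y - u t‖ ^ 2 := by ring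
    rw [← l3]
    refine le_of_tendsto_of_tendsto l1 l2 ?_
    filter_upwards [self_mem_nhdsWithin, hz.eventually_lt_const hD.rpos] with s hs hr
    have hs : t < s := hs
    have hk := hukey t s ht.1 hs.le hr y hy
    have hi := inv_pos.2 (sub_pos.2 hs)
    rw [slope_def_module, slope_def_field, ← smul_neg, neg_sub, real_inner_smul_left, div_eq_inv_mul,
      mul_assoc]
    gcongr
end Sweeping

section PerturbedSweeping
open Filter Topology

/-- Standing assumptions on the moving set of the perturbed sweeping process. -/
structure PSweepHyp {F : Type*} [NormedAddCommGroup F] [InnerProductSpace ℝ F]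
    (C : ℝ → Set F) (T0 T : ℝ) (w : ℝ → ℝ) (r K : ℝ) : Prop where
  closed : ∀ t ∈ Icc T0 T, IsClosed (C t)
  ne : ∀ t ∈ Icc T0 T, (C t).Nonempty
  wint : IntervalIntegrable w volume T0 T
  wnn : ∀ t ∈ Icc T0 T, 0 ≤ w t
  rpos : 0 < r
  Knn : 0 ≤ K
  move : ∀ s ∈ Icc T0 T, ∀ t ∈ Icc T0 T, |∫ τ in s..t, w τ| < r → ∀ x ∈ C s,
    ∃ x' ∈ C t, ‖x' - x‖ ≤ |∫ τ in s..t, w τ|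
  pr : ∀ t ∈ Icc T0 T, ∀ x ∈ C t, ∀ ζ : F, ∀ σ : ℝ,
    (∀ y ∈ C t, ⟪ζ, y - x⟫ ≤ σ * ‖y - x‖ ^ 2) →
    ∀ y ∈ C t, ⟪ζ, y - x⟫ ≤ K * ‖ζ‖ * ‖y - x‖ ^ 2

lemma abs_integral_add_nonneg {w k : ℝ → ℝ} {a b s t : ℝ}
    (hw : IntervalIntegrable w volume a b) (hk : IntervalIntegrable k volume a b)
    (hwn : ∀ t ∈ Icc a b, 0 ≤ w t) (hkn : ∀ t ∈ Icc a b, 0 ≤ k t)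
    (hs : s ∈ Icc a b) (ht : t ∈ Icc a b) :
    |∫ τ in s..t, (w τ + k τ)| = |∫ τ in s..t, w τ| + |∫ τ in s..t, k τ| := by
  have key : ∀ s ∈ Icc a b, ∀ t ∈ Icc a b, s ≤ t →
      |∫ τ in s..t, (w τ + k τ)| = |∫ τ in s..t, w τ| + |∫ τ in s..t, k τ| := by
    intro s hs t ht hst
    have h1 : 0 ≤ ∫ τ in s..t, w τ :=
      intervalIntegral.integral_nonneg hst fun r hr => hwn r ⟨hs.1.trans hr.1, hr.2.trans ht.2⟩
    have h2 : 0 ≤ ∫ τ in s..t, k τ :=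
      intervalIntegral.integral_nonneg hst fun r hr => hkn r ⟨hs.1.trans hr.1, hr.2.trans ht.2⟩
    rw [intervalIntegral.integral_add (ii_mono hw hs ht) (ii_mono hk hs ht), abs_of_nonneg h1,
      abs_of_nonneg h2, abs_of_nonneg (add_nonneg h1 h2)]
  rcases le_total s t with h | h
  · exact key s hs t ht h
  · rw [intervalIntegral.integral_symm t s, intervalIntegral.integral_symm t s (f := w),
      intervalIntegral.integral_symm t s (f := k), abs_neg, abs_neg, abs_neg]
    exact key t ht s hs h

lemma exists_psweep {n : ℕ} {C : ℝ → Set (EuclideanSpace ℝ (Fin n))} {w : ℝ → ℝ} {r K T0 T : ℝ}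
    (hC : PSweepHyp C T0 T w r K) (hT : T0 ≤ T) {x0 : EuclideanSpace ℝ (Fin n)} (hx0 : x0 ∈ C T0)
    {h : ℝ → EuclideanSpace ℝ (Fin n)} (hh : IntervalIntegrable h volume T0 T) :
    ∃ x x' : ℝ → EuclideanSpace ℝ (Fin n), x T0 = x0 ∧ IntervalIntegrable x' volume T0 T ∧
      (∀ t ∈ Icc T0 T, x t = x T0 + ∫ s in T0..t, x' s) ∧
      (∀ t ∈ Icc T0 T, x t ∈ C t) ∧
      ∀ᵐ t : ℝ, t ∈ Icc T0 T → ‖x' t + h t‖ ≤ w t + ‖h t‖ ∧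
        ∀ y ∈ C t, ⟪-x' t - h t, y - x t⟫ ≤ K * (w t + ‖h t‖) * ‖y - x t‖ ^ 2 := by
  have hT0 : T0 ∈ Icc T0 T := ⟨le_rfl, hT⟩
  let c : ℝ → ℝ := fun t => (projIcc T0 T hT t : ℝ)
  have hc : ∀ t, c t ∈ Icc T0 T := fun t => (projIcc T0 T hT t).2
  have hcI : ∀ t ∈ Icc T0 T, c t = t := fun t ht => by simp [c, projIcc_of_mem hT ht]
  let Hh : ℝ → EuclideanSpace ℝ (Fin n) := fun t => ∫ s in T0..t, h s
  let D : ℝ → Set (EuclideanSpace ℝ (Fin n)) := fun t => {z | z - Hh (c t) ∈ C (c t)}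
  have hwh : IntervalIntegrable (fun s => w s + ‖h s‖) volume T0 T := hC.wint.add hh.norm
  let V : ℝ → ℝ := fun t => ∫ s in T0..t, (w s + ‖h s‖)
  have hVd : ∀ s t, V (c t) - V (c s) = ∫ τ in (c s)..(c t), (w τ + ‖h τ‖) := fun s t =>
    intervalIntegral.integral_interval_sub_left (ii_mono hwh hT0 (hc t)) (ii_mono hwh hT0 (hc s))
  have hHd : ∀ s t, Hh (c t) - Hh (c s) = ∫ τ in (c s)..(c t), h τ := fun s t =>
    intervalIntegral.integral_interval_sub_left (ii_mono hh hT0 (hc t)) (ii_mono hh hT0 (hc s))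
  have hcm : Monotone c := fun s t hst => monotone_projIcc hT hst
  have hVac : AbsolutelyContinuousOnInterval V T0 T :=
    hwh.absolutelyContinuousOnInterval_intervalIntegral (c := T0) (by simp)
  have hD : SweepHyp D (fun t => V (c t)) r K := by
    refine ⟨?_, ?_, ?_, ?_, hC.rpos, hC.Knn, ?_, ?_⟩
    · intro t
      exact (hC.closed _ (hc t)).preimage (continuous_id.sub continuous_const)
    · intro t
      obtain ⟨z, hz⟩ := hC.ne _ (hc t)
      exact ⟨z + Hh (c t), by simpa [D] using hz⟩
    · intro s t hst
      rw [← sub_nonneg]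
      change 0 ≤ V (c t) - V (c s)
      rw [hVd]
      exact intervalIntegral.integral_nonneg (hcm hst) fun q hq =>
        add_nonneg (hC.wnn q ⟨(hc s).1.trans hq.1, hq.2.trans (hc t).2⟩) (norm_nonneg _)
    · have h1 : UniformContinuousOn V (Icc T0 T) := by
        have := hVac.uniformContinuousOn
        rwa [uIcc_of_le hT] at this
      have h2 : UniformContinuous c := by
        refine (LipschitzWith.mk_one (f := c) fun s t => ?_).uniformContinuous
        change dist (projIcc T0 T hT s : ℝ) (projIcc T0 T hT t : ℝ) ≤ dist s t
        rw [Real.dist_eq, Real.dist_eq]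
        exact abs_projIcc_sub_projIcc hT
      rw [Metric.uniformContinuous_iff] at h2 ⊢
      rw [Metric.uniformContinuousOn_iff] at h1
      intro ε hε
      obtain ⟨η, hη, hη'⟩ := h1 ε hε
      obtain ⟨η2, hη2, hη2'⟩ := h2 η hη
      exact ⟨η2, hη2, fun {a b} hab => hη' _ (hc _) _ (hc _) (hη2' hab)⟩
    · intro s t hst x hx
      change |V (c t) - V (c s)| < r at hst
      rw [hVd, abs_integral_add_nonneg hC.wint hh.norm hC.wnn (fun _ _ => norm_nonneg _) (hc s) (hc t)]
        at hst
      obtain ⟨x', hx', hx''⟩ := hC.move _ (hc s) _ (hc t)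
        (lt_of_le_of_lt (le_add_of_nonneg_right (abs_nonneg _)) hst) _ hx
      refine ⟨x' + Hh (c t), by simpa [D] using hx', ?_⟩
      change _ ≤ |V (c t) - V (c s)|
      rw [hVd, abs_integral_add_nonneg hC.wint hh.norm hC.wnn (fun _ _ => norm_nonneg _) (hc s) (hc t)]
      have e : x' + Hh (c t) - x = (x' - (x - Hh (c s))) + (Hh (c t) - Hh (c s)) := by abel
      rw [e]
      refine (norm_add_le _ _).trans (add_le_add hx'' ?_)
      rw [hHd]
      exact intervalIntegral.norm_integral_le_abs_integral_norm
    · intro t x hx ζ σ hσ y hy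
      have := hC.pr _ (hc t) _ hx ζ σ (fun z hz => by
        have := hσ (z + Hh (c t)) (by simpa [D] using hz)
        rw [show z + Hh (c t) - x = z - (x - Hh (c t)) by abel] at this
        exact this) _ hy
      rwa [sub_sub_sub_cancel_right] at this
  have hx0' : x0 ∈ D T0 := by
    simp only [D, mem_ofPred_eq]
    rw [hcI T0 hT0]
    simpa [Hh] using hx0
  obtain ⟨u, u', hu0, hu'i, hu', hum, hua⟩ := exists_sweep hD hT hx0' hwh
    (fun t ht => by simp only [V]; rw [hcI t ht])
  have hH0 : Hh T0 = 0 := by simp [Hh]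
  refine ⟨fun t => u t - Hh t, fun t => u' t - h t, ?_, hu'i.sub hh, ?_, ?_, ?_⟩
  · simp [hH0, hu0]
  · intro t ht
    simp only
    rw [intervalIntegral.integral_sub (ii_mono hu'i hT0 ht) (ii_mono hh hT0 ht), hu' t ht, hH0]
    simp only [Hh]
    abel
  · intro t ht
    have := hum t ht
    simp only [D, mem_ofPred_eq] at this
    rwa [hcI t ht] at this
  · filter_upwards [hua] with t hta ht
    obtain ⟨h1, h2⟩ := hta ht
    refine ⟨by simpa using h1, fun y hy => ?_⟩
    have := h2 (y + Hh t) (by simp only [D, mem_ofPred_eq]; rw [hcI t ht]; simpa using hy)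
    rw [show -(u' t - h t) - h t = -u' t by abel, show y - (u t - Hh t) = y + Hh t - u t by abel]
    exact this

end PerturbedSweeping

section Constraint
open Filter Topology

/-- Assumptions on a fixed-time constraint set. -/
structure ConHyp {n m : ℕ} (G : Fin m → EuclideanSpace ℝ (Fin n) → ℝ)
    (S : Set (EuclideanSpace ℝ (Fin n))) (r γ δ : ℝ) (y : EuclideanSpace ℝ (Fin n)) : Prop where
  hS : S = {x | ∀ k, G k x ≤ 0}
  rpos : 0 < r
  γpos : 0 < γ
  δpos : 0 < δ
  hy : ‖y‖ = 1
  diff : ∀ k z, Metric.infDist z S < r → DifferentiableAt ℝ (G k) z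
  hypo : ∀ k x, Metric.infDist x S < r → ∀ z, Metric.infDist z S < r →
    ⟪gradient (G k) x - gradient (G k) z, x - z⟫ ≥ -γ * ‖x - z‖ ^ 2
  grad : ∀ k x, Metric.infDist x S < r → ⟪gradient (G k) x, y⟫ ≤ -δ

variable {n m : ℕ} {G : Fin m → EuclideanSpace ℝ (Fin n) → ℝ}
    {S : Set (EuclideanSpace ℝ (Fin n))} {r γ δ : ℝ} {y : EuclideanSpace ℝ (Fin n)}

lemma ConHyp.near (hG : ConHyp G S r γ δ y) {x d : EuclideanSpace ℝ (Fin n)} (hx : x ∈ S)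
    (hd : ‖d‖ < r) {θ : ℝ} (h0 : 0 ≤ θ) (h1 : θ ≤ 1) : Metric.infDist (x + θ • d) S < r := by
  refine lt_of_le_of_lt (Metric.infDist_le_dist_of_mem hx) ?_
  rw [dist_eq_norm, add_sub_cancel_left, norm_smul, Real.norm_eq_abs, abs_of_nonneg h0]
  exact lt_of_le_of_lt (mul_le_of_le_one_left (norm_nonneg _) h1) hd

lemma ConHyp.near0 (hG : ConHyp G S r γ δ y) {x : EuclideanSpace ℝ (Fin n)} (hx : x ∈ S) :
    Metric.infDist x S < r := by
  rw [Metric.infDist_zero_of_mem hx]; exact hG.rpos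

lemma hasDerivAt_line {f : EuclideanSpace ℝ (Fin n) → ℝ} {x d : EuclideanSpace ℝ (Fin n)} {θ : ℝ}
    (hf : DifferentiableAt ℝ f (x + θ • d)) :
    HasDerivAt (fun s : ℝ => f (x + s • d)) ⟪gradient f (x + θ • d), d⟫ θ := by
  have h1 : HasDerivAt (fun s : ℝ => x + s • d) ((1 : ℝ) • d) θ :=
    ((hasDerivAt_id θ).smul_const d).const_add x
  rw [one_smul] at h1
  have h2 := hf.hasGradientAt.hasFDerivAt.comp_hasDerivAt θ h1
  exact h2

lemma ConHyp.mvt (hG : ConHyp G S r γ δ y) {x d : EuclideanSpace ℝ (Fin n)} (hx : x ∈ S)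
    (hd : ‖d‖ < r) (k : Fin m) : ∃ θ ∈ Ioo (0 : ℝ) 1,
      G k (x + d) - G k x = ⟪gradient (G k) (x + θ • d), d⟫ := by
  have hder : ∀ θ ∈ Icc (0 : ℝ) 1, HasDerivAt (fun s : ℝ => G k (x + s • d))
      ⟪gradient (G k) (x + θ • d), d⟫ θ := fun θ hθ =>
    hasDerivAt_line (hG.diff k _ (hG.near hx hd hθ.1 hθ.2))
  obtain ⟨θ, hθ, e⟩ := exists_hasDerivAt_eq_slope (fun s : ℝ => G k (x + s • d))
    (fun θ => ⟪gradient (G k) (x + θ • d), d⟫) one_pos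
    (fun θ hθ => (hder θ hθ).continuousAt.continuousWithinAt)
    (fun θ hθ => hder θ ⟨hθ.1.le, hθ.2.le⟩)
  refine ⟨θ, hθ, ?_⟩
  simp only [one_smul, zero_smul, add_zero, sub_zero, div_one] at e
  exact e.symm

lemma ConHyp.norm_ge (hG : ConHyp G S r γ δ y) {x : EuclideanSpace ℝ (Fin n)} (hx : x ∈ S)
    {z : Fin m → ℝ} (hz : ∀ k, 0 ≤ z k) :
    δ * ∑ k, z k ≤ ‖∑ k, z k • gradient (G k) x‖ := by
  have h1 : ⟪∑ k, z k • gradient (G k) x, y⟫ ≤ -(δ * ∑ k, z k) := by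
    rw [sum_inner, Finset.mul_sum, ← Finset.sum_neg_distrib]
    refine Finset.sum_le_sum fun k _ => ?_
    rw [real_inner_smul_left]
    nlinarith [hG.grad k x (hG.near0 hx), hz k]
  have h2 := (abs_le.1 (abs_real_inner_le_norm (∑ k, z k • gradient (G k) x) y)).1
  rw [hG.hy, mul_one] at h2
  linarith

lemma ConHyp.proxreg (hG : ConHyp G S r γ δ y) {x : EuclideanSpace ℝ (Fin n)} (hx : x ∈ S)
    {z : Fin m → ℝ} (hz : ∀ k, 0 ≤ z k) (hc : ∀ k, z k * G k x = 0)
    {p : EuclideanSpace ℝ (Fin n)} (hp : p ∈ S) :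
    ⟪∑ k, z k • gradient (G k) x, p - x⟫ ≤
      (γ / δ + 1 / r) * ‖∑ k, z k • gradient (G k) x‖ * ‖p - x‖ ^ 2 := by
  set ν := ∑ k, z k • gradient (G k) x with hν
  have hγ := hG.γpos
  have hδ := hG.δpos
  have hr := hG.rpos
  by_cases hd : ‖p - x‖ < r
  · have h1 : ⟪ν, p - x⟫ ≤ (∑ k, z k) * (γ * ‖p - x‖ ^ 2) := by
      rw [hν, sum_inner, Finset.sum_mul]
      refine Finset.sum_le_sum fun k _ => ?_
      rw [real_inner_smul_left]
      rcases (hz k).eq_or_lt with h0 | h0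
      · rw [← h0]; simp
      · have hgx : G k x = 0 := (mul_eq_zero.1 (hc k)).resolve_left h0.ne'
        have hgp : G k p ≤ 0 := by rw [hG.hS] at hp; exact hp k
        obtain ⟨θ, hθ, e⟩ := hG.mvt hx hd k
        rw [add_sub_cancel, hgx, sub_zero] at e
        have hh := hG.hypo k _ (hG.near hx hd hθ.1.le hθ.2.le) x (hG.near0 hx)
        rw [add_sub_cancel_left, real_inner_smul_right, norm_smul, Real.norm_eq_abs,
          abs_of_pos hθ.1, inner_sub_left, mul_pow] at hh
        have h3 : ⟪gradient (G k) (x + θ • (p - x)), p - x⟫ - ⟪gradient (G k) x, p - x⟫ ≥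
            -γ * (θ * ‖p - x‖ ^ 2) := by
          refine le_of_mul_le_mul_left ?_ hθ.1
          calc θ * (-γ * (θ * ‖p - x‖ ^ 2)) = -γ * (θ ^ 2 * ‖p - x‖ ^ 2) := by ring
            _ ≤ _ := hh
        have h4 : γ * (θ * ‖p - x‖ ^ 2) ≤ γ * ‖p - x‖ ^ 2 := by
          gcongr
          exact mul_le_of_le_one_left (by positivity) hθ.2.le
        gcongr
        linarith
    have h2 := hG.norm_ge hx hz
    rw [← hν] at h2
    have h3 : ∑ k, z k ≤ ‖ν‖ / δ := by rw [le_div_iff₀ hδ]; linarith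
    calc ⟪ν, p - x⟫ ≤ (∑ k, z k) * (γ * ‖p - x‖ ^ 2) := h1
      _ ≤ (‖ν‖ / δ) * (γ * ‖p - x‖ ^ 2) := by gcongr
      _ = (γ / δ) * ‖ν‖ * ‖p - x‖ ^ 2 := by ring
      _ ≤ _ := by
        gcongr
        have : 0 < 1 / r := by positivity
        linarith
  · push Not at hd
    calc ⟪ν, p - x⟫ ≤ ‖ν‖ * ‖p - x‖ := real_inner_le_norm _ _
      _ ≤ ‖ν‖ * (‖p - x‖ * (‖p - x‖ / r)) := by
        gcongr
        exact le_mul_of_one_le_right (norm_nonneg _) ((one_le_div hr).2 hd)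
      _ = (1 / r) * ‖ν‖ * ‖p - x‖ ^ 2 := by ring
      _ ≤ _ := by
        gcongr
        have : 0 < γ / δ := by positivity
        linarith

lemma ConHyp.kkt (hG : ConHyp G S r γ δ y) {x : EuclideanSpace ℝ (Fin n)} (hx : x ∈ S)
    {ζ : EuclideanSpace ℝ (Fin n)} {σ : ℝ} (hσ : ∀ p ∈ S, ⟪ζ, p - x⟫ ≤ σ * ‖p - x‖ ^ 2) :
    ∃ z : Fin m → ℝ, (∀ k, 0 ≤ z k) ∧ (∀ k, z k * G k x = 0) ∧
      ζ = ∑ k, z k • gradient (G k) x := by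
  classical
  have hgx : ∀ k, G k x ≤ 0 := by rw [hG.hS] at hx; exact hx
  let q : Option (Fin m) → EuclideanSpace ℝ (Fin n) := fun o =>
    o.elim (-ζ) (fun k => if G k x = 0 then gradient (G k) x else -ζ)
  let L : (Option (Fin m) → ℝ) →ₗ[ℝ] EuclideanSpace ℝ (Fin n) :=
    Fintype.linearCombination ℝ q
  have hLc : Continuous L := L.continuous_of_finiteDimensional
  set Q := L '' stdSimplex ℝ (Option (Fin m)) with hQ
  have hQconv : Convex ℝ Q := (convex_stdSimplex ℝ _).linear_image L
  have hQcomp : IsCompact Q := (isCompact_stdSimplex ℝ _).image hLc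
  by_cases h0 : (0 : EuclideanSpace ℝ (Fin n)) ∈ Q
  · obtain ⟨c, hc, hc0⟩ := h0
    have hcn := hc.1
    have hcs := hc.2
    have hsum : (c none) • (-ζ) + ∑ k, c (some k) • (if G k x = 0 then gradient (G k) x else -ζ) = 0 := by
      have := hc0
      simp only [L, Fintype.linearCombination_apply, Fintype.sum_option] at this
      exact this
    rw [Fintype.sum_option] at hcs
    set lam := c none + ∑ k, (if G k x = 0 then 0 else c (some k)) with hlam
    have hterm : ∀ k, c (some k) • (if G k x = 0 then gradient (G k) x else -ζ) =
        (if G k x = 0 then c (some k) else 0) • gradient (G k) x -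
        (if G k x = 0 then 0 else c (some k)) • ζ := by
      intro k; split_ifs <;> simp
    have hrep : lam • ζ = ∑ k, (if G k x = 0 then c (some k) else 0) • gradient (G k) x := by
      simp only [hterm] at hsum
      rw [Finset.sum_sub_distrib, ← Finset.sum_smul] at hsum
      rw [hlam, add_smul]
      rw [smul_neg] at hsum
      have := sub_eq_zero.1 (by rw [← hsum]; abel : (∑ k, (if G k x = 0 then c (some k) else 0) •
        gradient (G k) x) - (c none • ζ + (∑ k, (if G k x = 0 then 0 else c (some k))) • ζ) = 0)
      exact this.symm
    have hz0 : ∀ k, 0 ≤ (if G k x = 0 then c (some k) else 0) := by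
      intro k; split_ifs
      · exact hcn _
      · exact le_rfl
    have hlamnn : 0 ≤ lam := by
      refine add_nonneg (hcn _) (Finset.sum_nonneg fun k _ => ?_)
      split_ifs
      · exact le_rfl
      · exact hcn _
    have hlampos : 0 < lam := by
      refine lt_of_le_of_ne hlamnn fun h => ?_
      have h1 := hG.norm_ge hx hz0
      rw [← hrep, ← h, zero_smul, norm_zero] at h1
      have h2 : lam + ∑ k, (if G k x = 0 then c (some k) else 0) = 1 := by
        rw [← hcs, hlam, add_assoc, ← Finset.sum_add_distrib]
        congr 1
        refine Finset.sum_congr rfl fun k _ => ?_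
        split_ifs <;> simp
      rw [← h, zero_add] at h2
      rw [h2] at h1
      linarith [hG.δpos]
    refine ⟨fun k => lam⁻¹ * (if G k x = 0 then c (some k) else 0), fun k =>
      mul_nonneg (inv_nonneg.2 hlamnn) (hz0 k), fun k => ?_, ?_⟩
    · by_cases hk : G k x = 0 <;> simp [hk]
    · simp only [mul_smul]
      rw [← Finset.smul_sum, ← hrep, smul_smul, inv_mul_cancel₀ hlampos.ne', one_smul]
  · exfalso
    obtain ⟨f, u, hf0, hfu⟩ := geometric_hahn_banach_point_closed hQconv hQcomp.isClosed h0
    rw [map_zero] at hf0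
    let d : EuclideanSpace ℝ (Fin n) := -((InnerProductSpace.toDual ℝ _).symm f)
    have hfd : ∀ p, f p = -⟪p, d⟫ := by
      intro p
      simp only [d, inner_neg_right, neg_neg]
      rw [real_inner_comm, InnerProductSpace.toDual_symm_apply]
    have hqQ : ∀ o, q o ∈ Q := by
      intro o
      refine ⟨Pi.single o 1, single_mem_stdSimplex ℝ o, ?_⟩
      simp [L, Fintype.linearCombination_apply_single]
    have hζ : 0 < ⟪ζ, d⟫ := by
      have := hfu _ (hqQ none)
      rw [hfd] at this
      simp only [q, Option.elim, inner_neg_left] at this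
      linarith
    have hact : ∀ k, G k x = 0 → ⟪gradient (G k) x, d⟫ < 0 := by
      intro k hk
      have := hfu _ (hqQ (some k))
      rw [hfd] at this
      simp only [q, Option.elim, hk, if_true] at this
      linarith
    have hev : ∀ k, ∀ᶠ s in 𝓝[>] (0 : ℝ), G k (x + s • d) ≤ 0 := by
      intro k
      have hx' : x + (0 : ℝ) • d = x := by simp
      have hder := hasDerivAt_line (f := G k) (x := x) (d := d) (θ := 0)
        (by rw [hx']; exact hG.diff k x (hG.near0 hx))
      rw [hx'] at hder
      rcases (hgx k).lt_or_eq with hlt | heq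
      · have hcont := hder.continuousAt
        have : ∀ᶠ s in 𝓝 (0 : ℝ), G k (x + s • d) < 0 :=
          hcont.eventually_lt continuousAt_const (by simpa using hlt)
        filter_upwards [this.filter_mono nhdsWithin_le_nhds] with s hs using hs.le
      · have hs := hder.tendsto_slope.mono_left (nhdsGT_le_nhdsNE 0)
        filter_upwards [hs.eventually_lt_const (hact k heq), self_mem_nhdsWithin] with s h1 h2
        have h2 : (0 : ℝ) < s := h2
        rw [slope_def_field] at h1
        simp only [zero_smul, add_zero, sub_zero, heq] at h1
        exact le_of_lt (by have := (div_lt_iff₀ h2).1 h1; linarith)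
    have hevall : ∀ᶠ s in 𝓝[>] (0 : ℝ), ⟪ζ, d⟫ ≤ σ * s * ‖d‖ ^ 2 := by
      filter_upwards [eventually_all.2 hev, self_mem_nhdsWithin] with s h1 h2
      have h2 : (0 : ℝ) < s := h2
      have := hσ (x + s • d) (by rw [hG.hS]; exact h1)
      rw [add_sub_cancel_left, real_inner_smul_right, norm_smul, Real.norm_eq_abs, abs_of_pos h2] at this
      refine le_of_mul_le_mul_left ?_ h2
      calc s * ⟪ζ, d⟫ ≤ _ := this
        _ = _ := by ring
    have hlim : Tendsto (fun s : ℝ => σ * s * ‖d‖ ^ 2) (𝓝[>] 0) (𝓝 (σ * 0 * ‖d‖ ^ 2)) :=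
      tendsto_nhdsWithin_of_tendsto_nhds (Continuous.tendsto (by fun_prop) _)
    have := ge_of_tendsto hlim hevall
    simp at this
    linarith

lemma ConHyp.descend (hG : ConHyp G S r γ δ y) {x : EuclideanSpace ℝ (Fin n)} (hx : x ∈ S)
    {ε : ℝ} (h0 : 0 ≤ ε) (hε : ε < r) (k : Fin m) : G k (x + ε • y) ≤ -(δ * ε) := by
  have hn : ‖ε • y‖ < r := by
    rw [norm_smul, hG.hy, mul_one, Real.norm_eq_abs, abs_of_nonneg h0]; exact hε
  obtain ⟨θ, hθ, e⟩ := hG.mvt hx hn k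
  have h1 := hG.grad k _ (hG.near hx hn hθ.1.le hθ.2.le)
  rw [real_inner_smul_right] at e
  have h2 : G k x ≤ 0 := by rw [hG.hS] at hx; exact hx k
  nlinarith

end Constraint

section FromConstraints
variable {n m : ℕ}

lemma conHyp_of {G : Fin m → EuclideanSpace ℝ (Fin n) → ℝ} {S : Set (EuclideanSpace ℝ (Fin n))}
    {ρ r : ℝ≥0∞} {γ δ : ℝ} {y : EuclideanSpace ℝ (Fin n)}
    (hS : S = {x | ∀ k, G k x ≤ 0})
    (hdiff : ∀ k : Fin m, ContDiffOn ℝ 1 (G k) {y | ENNReal.ofReal (Metric.infDist y S) < ρ})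
    (hγ : 0 < γ)
    (hhypo : ∀ k : Fin m,
      ∀ x ∈ {y : EuclideanSpace ℝ (Fin n) | ENNReal.ofReal (Metric.infDist y S) < ρ},
      ∀ z ∈ {y : EuclideanSpace ℝ (Fin n) | ENNReal.ofReal (Metric.infDist y S) < ρ},
        ⟪gradient (G k) x - gradient (G k) z, x - z⟫ ≥ -γ * ‖x - z‖ ^ 2)
    (hr0 : 0 < r) (hrt : r ≠ ⊤) (hrρ : r ≤ ρ) (hδ : 0 < δ) (hy : ‖y‖ = 1)
    (hgrad : ∀ i : Fin m,
      ∀ x : EuclideanSpace ℝ (Fin n), ENNReal.ofReal (Metric.infDist x S) < r →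
        ⟪gradient (G i) x, y⟫ ≤ -δ) :
    ConHyp G S r.toReal γ δ y := by
  have conv : ∀ x : EuclideanSpace ℝ (Fin n), Metric.infDist x S < r.toReal →
      ENNReal.ofReal (Metric.infDist x S) < r := fun x hx =>
    (ENNReal.ofReal_lt_iff_lt_toReal Metric.infDist_nonneg hrt).2 hx
  have hopen : IsOpen {y : EuclideanSpace ℝ (Fin n) | ENNReal.ofReal (Metric.infDist y S) < ρ} :=
    isOpen_lt (ENNReal.continuous_ofReal.comp (Metric.continuous_infDist_pt S)) continuous_const
  refine ⟨hS, ENNReal.toReal_pos hr0.ne' hrt, hγ, hδ, hy, ?_, ?_, ?_⟩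
  · intro k z hz
    exact ((hdiff k).contDiffAt (hopen.mem_nhds ((conv z hz).trans_le hrρ))).differentiableAt
      one_ne_zero
  · intro k x hx z hz
    exact hhypo k x ((conv x hx).trans_le hrρ) z ((conv z hz).trans_le hrρ)
  · intro k x hx
    exact hgrad k x (conv x hx)

lemma psweep_of {g : Fin m → ℝ → EuclideanSpace ℝ (Fin n) → ℝ}
    {C : ℝ → Set (EuclideanSpace ℝ (Fin n))} {T0 T r γ δ : ℝ} {y : EuclideanSpace ℝ (Fin n)}
    (hne : ∀ t ∈ Icc T0 T, (C t).Nonempty) (hcl : ∀ t ∈ Icc T0 T, IsClosed (C t))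
    (hG : ∀ t ∈ Icc T0 T, ConHyp (fun k => g k t) (C t) r γ δ y)
    (hT : T0 ≤ T) {w w' : ℝ → ℝ} (hwint : IntervalIntegrable w' volume T0 T)
    (hwAC : ∀ t ∈ Icc T0 T, w t = w T0 + ∫ s in T0..t, w' s)
    (hmono : ∀ i : Fin m, ∀ s ∈ Icc T0 T, ∀ t ∈ Icc T0 T,
      ∀ x : EuclideanSpace ℝ (Fin n), Metric.infDist x (C s) < r →
        g i t x ≤ g i s x + |w t - w s|) :
    PSweepHyp C T0 T (fun s => |w' s| / δ) r (γ / δ + 1 / r) := by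
  have hT0 : T0 ∈ Icc T0 T := ⟨le_rfl, hT⟩
  have h0 := hG T0 hT0
  have hγ := h0.γpos
  have hδ := h0.δpos
  have hr := h0.rpos
  refine ⟨hcl, hne, hwint.abs.div_const _, fun t _ => by positivity, hr, by positivity, ?_, ?_⟩
  · intro s hs t ht hlt x hx
    set ε := |∫ τ in s..t, |w' τ| / δ| with hε
    have hwst : w t - w s = ∫ τ in s..t, w' τ := by
      rw [hwAC t ht, hwAC s hs, add_sub_add_left_eq_sub,
        intervalIntegral.integral_interval_sub_left (ii_mono hwint hT0 ht) (ii_mono hwint hT0 hs)]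
    have hle : |w t - w s| ≤ δ * ε := by
      rw [hwst, hε, intervalIntegral.integral_div, abs_div, abs_of_pos hδ, mul_div_cancel₀ _ hδ.ne']
      simpa using intervalIntegral.norm_integral_le_abs_integral_norm (f := w') (a := s) (b := t)
        (μ := volume)
    have hε0 : 0 ≤ ε := abs_nonneg _
    have hn : ‖ε • y‖ < r := by
      rw [norm_smul, h0.hy, mul_one, Real.norm_eq_abs, abs_of_nonneg hε0]; exact hlt
    refine ⟨x + ε • y, ?_, ?_⟩
    · rw [(hG t ht).hS]
      intro k
      have h1 := (hG s hs).descend hx hε0 hlt k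
      have h2 := hmono k s hs t ht (x + ε • y)
        (by simpa using (hG s hs).near hx hn zero_le_one le_rfl)
      linarith
    · rw [add_sub_cancel_left, norm_smul, h0.hy, mul_one, Real.norm_eq_abs, abs_of_nonneg hε0]
  · intro t ht x hx ζ σ hζ p hp
    obtain ⟨z, hz0, hz1, rfl⟩ := (hG t ht).kkt hx hζ
    exact (hG t ht).proxreg hx hz0 hz1 hp

end FromConstraints

section Perturbation
variable {n : ℕ}

/-- Hypotheses on the integro-differential perturbation. -/
structure PertHyp (D : Set (EuclideanSpace ℝ (Fin n))) (T0 T : ℝ)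
    (f1 : ℝ → EuclideanSpace ℝ (Fin n) → EuclideanSpace ℝ (Fin n))
    (f2 : ℝ → ℝ → EuclideanSpace ℝ (Fin n) → EuclideanSpace ℝ (Fin n))
    (β1 : ℝ → ℝ) (β2 : ℝ → ℝ → ℝ) : Prop where
  m1 : ∀ x : EuclideanSpace ℝ (Fin n), StronglyMeasurable fun t => f1 t x
  i1 : IntervalIntegrable β1 volume T0 T
  n1 : ∀ t ∈ Icc T0 T, 0 ≤ β1 t
  g1 : ∀ t ∈ Icc T0 T, ∀ x ∈ D, ‖f1 t x‖ ≤ β1 t * (1 + ‖x‖)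
  l1 : ∀ η : ℝ, 0 < η → ∃ L1 : ℝ → ℝ, IntervalIntegrable L1 volume T0 T ∧
      (∀ t ∈ Icc T0 T, 0 ≤ L1 t) ∧
      ∀ t ∈ Icc T0 T, ∀ x ∈ Metric.closedBall (0 : EuclideanSpace ℝ (Fin n)) η,
        ∀ y ∈ Metric.closedBall (0 : EuclideanSpace ℝ (Fin n)) η, ‖f1 t x - f1 t y‖ ≤ L1 t * ‖x - y‖
  m2 : ∀ x : EuclideanSpace ℝ (Fin n), StronglyMeasurable fun p : ℝ × ℝ => f2 p.1 p.2 x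
  i2 : IntegrableOn (fun p : ℝ × ℝ => β2 p.1 p.2)
      {p : ℝ × ℝ | p.1 ∈ Icc T0 T ∧ p.2 ∈ Icc T0 T ∧ p.2 ≤ p.1} volume
  n2 : ∀ t ∈ Icc T0 T, ∀ s ∈ Icc T0 t, 0 ≤ β2 t s
  g2 : ∀ t ∈ Icc T0 T, ∀ s ∈ Icc T0 t, ∀ x ∈ D, ‖f2 t s x‖ ≤ β2 t s * (1 + ‖x‖)
  l2 : ∀ η : ℝ, 0 < η → ∃ L2 : ℝ → ℝ, IntervalIntegrable L2 volume T0 T ∧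
      (∀ t ∈ Icc T0 T, 0 ≤ L2 t) ∧
      ∀ t ∈ Icc T0 T, ∀ s ∈ Icc T0 t, ∀ x ∈ Metric.closedBall (0 : EuclideanSpace ℝ (Fin n)) η,
        ∀ y ∈ Metric.closedBall (0 : EuclideanSpace ℝ (Fin n)) η, ‖f2 t s x - f2 t s y‖ ≤ L2 t * ‖x - y‖

/-- The perturbation along a trajectory. -/
def pert (T0 : ℝ) (f1 : ℝ → EuclideanSpace ℝ (Fin n) → EuclideanSpace ℝ (Fin n))
    (f2 : ℝ → ℝ → EuclideanSpace ℝ (Fin n) → EuclideanSpace ℝ (Fin n))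
    (x : ℝ → EuclideanSpace ℝ (Fin n)) (t : ℝ) : EuclideanSpace ℝ (Fin n) :=
  f1 t (x t) + ∫ s in T0..t, f2 t s (x s)

/-- The triangle. -/
def triSet (T0 T : ℝ) : Set (ℝ × ℝ) := {p : ℝ × ℝ | p.1 ∈ Icc T0 T ∧ p.2 ∈ Icc T0 T ∧ p.2 ≤ p.1}

lemma measurableSet_triSet (T0 T : ℝ) : MeasurableSet (triSet T0 T) := by
  have h1 : IsClosed (triSet T0 T) :=
    (isClosed_Icc.preimage continuous_fst).inter
      ((isClosed_Icc.preimage continuous_snd).inter (isClosed_le continuous_snd continuous_fst))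
  exact h1.measurableSet

lemma triSet_indicator {F : Type*} [Zero F] {T0 T t : ℝ} (ht : t ∈ Icc T0 T) (u : ℝ × ℝ → F) :
    (fun s => (triSet T0 T).indicator u (t, s)) = (Icc T0 t).indicator (fun s => u (t, s)) := by
  funext s
  by_cases hs : s ∈ Icc T0 t
  · rw [indicator_of_mem hs, indicator_of_mem]
    exact ⟨ht, ⟨hs.1, hs.2.trans ht.2⟩, hs.2⟩
  · rw [indicator_of_notMem hs, indicator_of_notMem]
    exact fun h => hs ⟨h.2.1.1, h.2.2⟩

lemma triSet_integral {F : Type*} [NormedAddCommGroup F] [NormedSpace ℝ F]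
    {T0 T t : ℝ} (ht : t ∈ Icc T0 T) (u : ℝ × ℝ → F) :
    ∫ s, (triSet T0 T).indicator u (t, s) = ∫ s in T0..t, u (t, s) := by
  rw [show (∫ s, (triSet T0 T).indicator u (t, s)) = ∫ s, (Icc T0 t).indicator (fun s => u (t, s)) s by
    rw [← triSet_indicator ht], integral_indicator measurableSet_Icc, integral_Icc_eq_integral_Ioc,
    intervalIntegral.integral_of_le ht.1]

variable {D : Set (EuclideanSpace ℝ (Fin n))} {T0 T : ℝ}
    {f1 : ℝ → EuclideanSpace ℝ (Fin n) → EuclideanSpace ℝ (Fin n)}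
    {f2 : ℝ → ℝ → EuclideanSpace ℝ (Fin n) → EuclideanSpace ℝ (Fin n)}
    {β1 : ℝ → ℝ} {β2 : ℝ → ℝ → ℝ}

lemma PertHyp.b2_ae (P : PertHyp D T0 T f1 f2 β1 β2) :
    ∀ᵐ t : ℝ, t ∈ Icc T0 T → IntervalIntegrable (β2 t) volume T0 t := by
  have h := (integrable_indicator_iff (measurableSet_triSet T0 T)).2 P.i2
  rw [Measure.volume_eq_prod] at h
  filter_upwards [h.prod_right_ae] with t ht htI
  rw [triSet_indicator htI, integrable_indicator_iff measurableSet_Icc] at ht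
  exact (intervalIntegrable_iff_integrableOn_Icc_of_le htI.1).2 ht

lemma PertHyp.b2_int (P : PertHyp D T0 T f1 f2 β1 β2) (hT : T0 ≤ T) :
    IntervalIntegrable (fun t => ∫ s in T0..t, β2 t s) volume T0 T := by
  have h := (integrable_indicator_iff (measurableSet_triSet T0 T)).2 P.i2
  rw [Measure.volume_eq_prod] at h
  have h2 := h.integral_prod_left
  rw [intervalIntegrable_iff_integrableOn_Icc_of_le hT]
  refine IntegrableOn.congr_fun (h2.integrableOn (s := Icc T0 T)) (fun t ht => ?_) measurableSet_Icc
  exact triSet_integral ht _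

lemma continuous_of_lip_balls {u : EuclideanSpace ℝ (Fin n) → EuclideanSpace ℝ (Fin n)}
    (h : ∀ η : ℝ, 0 < η → ∃ L : ℝ, 0 ≤ L ∧ ∀ x ∈ Metric.closedBall (0 : EuclideanSpace ℝ (Fin n)) η,
      ∀ y ∈ Metric.closedBall (0 : EuclideanSpace ℝ (Fin n)) η, ‖u x - u y‖ ≤ L * ‖x - y‖) :
    Continuous u := by
  rw [continuous_iff_continuousAt]
  intro x
  obtain ⟨L, hL, hl⟩ := h (‖x‖ + 1) (by positivity)
  have : LipschitzOnWith L.toNNReal u (Metric.closedBall 0 (‖x‖ + 1)) :=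
    LipschitzOnWith.of_dist_le_mul fun a ha b hb => by
      rw [dist_eq_norm, dist_eq_norm, Real.coe_toNNReal _ hL]; exact hl a ha b hb
  exact this.continuousOn.continuousAt
    (Metric.closedBall_mem_nhds_of_mem (by simp [Metric.mem_ball]))

lemma PertHyp.meas1 (P : PertHyp D T0 T f1 f2 β1 β2) {x : ℝ → EuclideanSpace ℝ (Fin n)}
    (hx : Continuous x) : StronglyMeasurable fun t => (Icc T0 T).indicator (fun t => f1 t (x t)) t := by
  have h1 : StronglyMeasurable (Function.uncurry fun (a : EuclideanSpace ℝ (Fin n)) (t : ℝ) =>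
      (Icc T0 T).indicator (fun t => f1 t a) t) := by
    refine stronglyMeasurable_uncurry_of_continuous_of_stronglyMeasurable ?_ ?_
    · intro t
      by_cases ht : t ∈ Icc T0 T
      · simp only [indicator_of_mem ht]
        refine continuous_of_lip_balls fun η hη => ?_
        obtain ⟨L, _, hL, hl⟩ := P.l1 η hη
        exact ⟨L t, hL t ht, hl t ht⟩
      · simp only [indicator_of_notMem ht]
        exact continuous_const
    · intro a
      exact (P.m1 a).indicator measurableSet_Icc
  have h2 := h1.comp_measurable (hx.measurable.prodMk measurable_id)
  exact h2

lemma PertHyp.meas2 (P : PertHyp D T0 T f1 f2 β1 β2) {x : ℝ → EuclideanSpace ℝ (Fin n)}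
    (hx : Continuous x) : StronglyMeasurable fun p : ℝ × ℝ =>
      (triSet T0 T).indicator (fun p => f2 p.1 p.2 (x p.2)) p := by
  have h1 : StronglyMeasurable (Function.uncurry fun (a : EuclideanSpace ℝ (Fin n)) (p : ℝ × ℝ) =>
      (triSet T0 T).indicator (fun p => f2 p.1 p.2 a) p) := by
    refine stronglyMeasurable_uncurry_of_continuous_of_stronglyMeasurable ?_ ?_
    · intro t
      by_cases ht : t ∈ triSet T0 T
      · simp only [indicator_of_mem ht]
        refine continuous_of_lip_balls fun η hη => ?_
        obtain ⟨L, _, hL, hl⟩ := P.l2 η hη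
        exact ⟨L t.1, hL _ ht.1, hl _ ht.1 _ ⟨ht.2.1.1, ht.2.2⟩⟩
      · simp only [indicator_of_notMem ht]
        exact continuous_const
    · intro a
      exact (P.m2 a).indicator (measurableSet_triSet T0 T)
  have h2 := h1.comp_measurable ((hx.comp continuous_snd).measurable.prodMk measurable_id)
  exact h2

lemma exists_cont_ext (hT : T0 ≤ T) {x : ℝ → EuclideanSpace ℝ (Fin n)}
    (hx : ContinuousOn x (Icc T0 T)) : ∃ u : ℝ → EuclideanSpace ℝ (Fin n), Continuous u ∧
      ∀ t ∈ Icc T0 T, u t = x t :=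
  ⟨IccExtend hT ((Icc T0 T).domRestrict x), (continuousOn_iff_continuous_domRestrict.1 hx).Icc_extend',
    fun t ht => by rw [IccExtend_of_mem _ _ ht]; rfl⟩

/-- Congruence on the interval. -/
lemma pert_congr {x u : ℝ → EuclideanSpace ℝ (Fin n)} (h : ∀ t ∈ Icc T0 T, u t = x t) {t : ℝ}
    (ht : t ∈ Icc T0 T) : pert T0 f1 f2 u t = pert T0 f1 f2 x t := by
  unfold pert
  rw [h t ht]
  congr 1
  refine intervalIntegral.integral_congr fun s hs => ?_
  rw [uIcc_of_le ht.1] at hs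
  simp only [h s ⟨hs.1, hs.2.trans ht.2⟩]

lemma PertHyp.pert_meas (P : PertHyp D T0 T f1 f2 β1 β2) (hT : T0 ≤ T)
    {x : ℝ → EuclideanSpace ℝ (Fin n)} (hx : ContinuousOn x (Icc T0 T)) :
    AEStronglyMeasurable (pert T0 f1 f2 x) (volume.restrict (Icc T0 T)) := by
  obtain ⟨u, hu, hux⟩ := exists_cont_ext hT hx
  have h1 := P.meas1 hu
  have h2 := (P.meas2 hu).integral_prod_right' (ν := volume)
  refine ⟨_, h1.add h2, ?_⟩
  filter_upwards [ae_restrict_mem measurableSet_Icc] with t ht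
  rw [← pert_congr hux ht]
  simp only [Pi.add_apply, indicator_of_mem ht]
  rw [triSet_integral ht]
  rfl

lemma PertHyp.f2_int (P : PertHyp D T0 T f1 f2 β1 β2) (hT : T0 ≤ T)
    {x : ℝ → EuclideanSpace ℝ (Fin n)} (hx : ContinuousOn x (Icc T0 T))
    (hxD : ∀ t ∈ Icc T0 T, x t ∈ D) :
    ∀ᵐ t : ℝ, t ∈ Icc T0 T → IntervalIntegrable (fun s => f2 t s (x s)) volume T0 t := by
  obtain ⟨u, hu, hux⟩ := exists_cont_ext hT hx
  obtain ⟨R, hR⟩ := (isCompact_Icc (a := T0) (b := T)).exists_bound_of_continuousOn hx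
  filter_upwards [P.b2_ae] with t hb ht
  have hb := hb ht
  have hm : StronglyMeasurable fun s => (triSet T0 T).indicator (fun p => f2 p.1 p.2 (u p.2)) (t, s) :=
    (P.meas2 hu).comp_measurable measurable_prodMk_left
  rw [intervalIntegrable_iff_integrableOn_Icc_of_le ht.1] at hb ⊢
  refine Integrable.mono' (hb.mul_const (1 + R)) ⟨_, hm, ?_⟩ ?_
  · filter_upwards [ae_restrict_mem measurableSet_Icc] with s hs
    have : (t, s) ∈ triSet T0 T := ⟨ht, ⟨hs.1, hs.2.trans ht.2⟩, hs.2⟩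
    rw [indicator_of_mem this, hux s this.2.1]
  · filter_upwards [ae_restrict_mem measurableSet_Icc] with s hs
    have hs' : s ∈ Icc T0 T := ⟨hs.1, hs.2.trans ht.2⟩
    refine (P.g2 t ht s hs _ (hxD s hs')).trans ?_
    exact mul_le_mul_of_nonneg_left (by linarith [hR s hs']) (P.n2 t ht s hs)

lemma PertHyp.pert_bound (P : PertHyp D T0 T f1 f2 β1 β2)
    {x : ℝ → EuclideanSpace ℝ (Fin n)} (hxD : ∀ t ∈ Icc T0 T, x t ∈ D) :
    ∀ᵐ t : ℝ, t ∈ Icc T0 T → ∀ R : ℝ, (∀ s ∈ Icc T0 t, ‖x s‖ ≤ R) →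
      ‖pert T0 f1 f2 x t‖ ≤ (β1 t + ∫ s in T0..t, β2 t s) * (1 + R) := by
  filter_upwards [P.b2_ae] with t hb ht R hR
  have hb := hb ht
  have htt : t ∈ Icc T0 t := ⟨ht.1, le_rfl⟩
  unfold pert
  refine (norm_add_le _ _).trans ?_
  rw [add_mul]
  refine add_le_add ?_ ?_
  · exact (P.g1 t ht _ (hxD t ht)).trans
      (mul_le_mul_of_nonneg_left (by linarith [hR t htt]) (P.n1 t ht))
  · rw [← intervalIntegral.integral_mul_const]
    refine intervalIntegral.norm_integral_le_of_norm_le ht.1 ?_ (hb.mul_const _)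
    refine Filter.Eventually.of_forall fun s hs => ?_
    have hs : s ∈ Icc T0 t := Ioc_subset_Icc_self hs
    refine (P.g2 t ht s hs _ (hxD s ⟨hs.1, hs.2.trans ht.2⟩)).trans ?_
    exact mul_le_mul_of_nonneg_left (by linarith [hR s hs]) (P.n2 t ht s hs)

lemma PertHyp.b2_nonneg (P : PertHyp D T0 T f1 f2 β1 β2) {t : ℝ} (ht : t ∈ Icc T0 T) :
    0 ≤ ∫ s in T0..t, β2 t s :=
  intervalIntegral.integral_nonneg ht.1 fun s hs => P.n2 t ht s hs

lemma PertHyp.pert_int (P : PertHyp D T0 T f1 f2 β1 β2) (hT : T0 ≤ T)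
    {x : ℝ → EuclideanSpace ℝ (Fin n)} (hx : ContinuousOn x (Icc T0 T))
    (hxD : ∀ t ∈ Icc T0 T, x t ∈ D) : IntervalIntegrable (pert T0 f1 f2 x) volume T0 T := by
  obtain ⟨R, hR⟩ := (isCompact_Icc (a := T0) (b := T)).exists_bound_of_continuousOn hx
  have hi := (P.i1.add (P.b2_int hT)).mul_const (1 + R)
  rw [intervalIntegrable_iff_integrableOn_Icc_of_le hT] at hi ⊢
  refine Integrable.mono' hi (P.pert_meas hT hx) ?_
  rw [ae_restrict_iff' measurableSet_Icc]
  filter_upwards [P.pert_bound hxD] with t h ht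
  exact h ht R fun s hs => hR s ⟨hs.1, hs.2.trans ht.2⟩

lemma PertHyp.pert_diff (P : PertHyp D T0 T f1 f2 β1 β2) (hT : T0 ≤ T)
    {x y : ℝ → EuclideanSpace ℝ (Fin n)} (hx : ContinuousOn x (Icc T0 T))
    (hxD : ∀ t ∈ Icc T0 T, x t ∈ D) (hy : ContinuousOn y (Icc T0 T))
    (hyD : ∀ t ∈ Icc T0 T, y t ∈ D) {η : ℝ} (hxη : ∀ t ∈ Icc T0 T, ‖x t‖ ≤ η)
    (hyη : ∀ t ∈ Icc T0 T, ‖y t‖ ≤ η) {L1 L2 : ℝ → ℝ}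
    (hL1 : ∀ t ∈ Icc T0 T, ∀ x ∈ Metric.closedBall (0 : EuclideanSpace ℝ (Fin n)) η,
        ∀ y ∈ Metric.closedBall (0 : EuclideanSpace ℝ (Fin n)) η, ‖f1 t x - f1 t y‖ ≤ L1 t * ‖x - y‖)
    (hL2 : ∀ t ∈ Icc T0 T, ∀ s ∈ Icc T0 t, ∀ x ∈ Metric.closedBall (0 : EuclideanSpace ℝ (Fin n)) η,
        ∀ y ∈ Metric.closedBall (0 : EuclideanSpace ℝ (Fin n)) η, ‖f2 t s x - f2 t s y‖ ≤ L2 t * ‖x - y‖) :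
    ∀ᵐ t : ℝ, t ∈ Icc T0 T → ‖pert T0 f1 f2 x t - pert T0 f1 f2 y t‖ ≤
      L1 t * ‖x t - y t‖ + L2 t * ∫ s in T0..t, ‖x s - y s‖ := by
  filter_upwards [P.f2_int hT hx hxD, P.f2_int hT hy hyD] with t h1 h2 ht
  have hsub : Icc T0 t ⊆ Icc T0 T := Icc_subset_Icc_right ht.2
  unfold pert
  rw [add_sub_add_comm, ← intervalIntegral.integral_sub (h1 ht) (h2 ht)]
  refine (norm_add_le _ _).trans (add_le_add ?_ ?_)
  · exact hL1 t ht _ (by simpa using hxη t ht) _ (by simpa using hyη t ht)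
  · rw [← intervalIntegral.integral_const_mul]
    refine intervalIntegral.norm_integral_le_of_norm_le ht.1 ?_ ?_
    · refine Filter.Eventually.of_forall fun s hs => ?_
      have hs : s ∈ Icc T0 t := Ioc_subset_Icc_self hs
      exact hL2 t ht s hs _ (by simpa using hxη s (hsub hs)) _ (by simpa using hyη s (hsub hs))
    · refine ContinuousOn.intervalIntegrable ?_
      rw [uIcc_of_le ht.1]
      exact continuousOn_const.mul ((hx.mono hsub).sub (hy.mono hsub)).norm

end Perturbation

section Picard

lemma picard_step {T0 T M c : ℝ} (hT : T0 ≤ T) (hM : 0 < M) (hc : 0 ≤ c) {L1 L2 ψ d φ : ℝ → ℝ}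
    (hL1 : IntervalIntegrable L1 volume T0 T) (hL1n : ∀ t ∈ Icc T0 T, 0 ≤ L1 t)
    (hL2 : IntervalIntegrable L2 volume T0 T) (hL2n : ∀ t ∈ Icc T0 T, 0 ≤ L2 t)
    (hψc : ContinuousOn ψ (Icc T0 T))
    (hψ : ∀ t ∈ Icc T0 T, ψ t ≤ c * Real.exp (2 * M * ∫ s in T0..t, (L1 s + (T - T0) * L2 s)))
    (hd : IntervalIntegrable d volume T0 T)
    (hdle : ∀ᵐ t : ℝ, t ∈ Icc T0 T → d t ≤ L1 t * ψ t + L2 t * ∫ s in T0..t, ψ s)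
    (hφ : ∀ t ∈ Icc T0 T, φ t ≤ M * ∫ s in T0..t, d s) :
    ∀ t ∈ Icc T0 T, φ t ≤ c / 2 * Real.exp (2 * M * ∫ s in T0..t, (L1 s + (T - T0) * L2 s)) := by
  intro t ht
  have hT0 : T0 ∈ Icc T0 T := ⟨le_rfl, hT⟩
  set l : ℝ → ℝ := fun s => L1 s + (T - T0) * L2 s with hl
  have hTT : 0 ≤ T - T0 := by linarith
  have hli : IntervalIntegrable l volume T0 T := hL1.add (hL2.const_mul _)
  have hln : ∀ t ∈ Icc T0 T, 0 ≤ l t := fun t ht =>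
    add_nonneg (hL1n t ht) (mul_nonneg hTT (hL2n t ht))
  have hmono : ∀ s ∈ Icc T0 T, ∀ u ∈ Icc T0 T, s ≤ u → ∫ r in T0..s, l r ≤ ∫ r in T0..u, l r := by
    intro s hs u hu hsu
    have h1 := intervalIntegral.integral_add_adjacent_intervals (ii_mono hli hT0 hs)
      (ii_mono hli hs hu)
    have h2 : 0 ≤ ∫ r in s..u, l r := intervalIntegral.integral_nonneg hsu fun r hr =>
      hln r ⟨hs.1.trans hr.1, hr.2.trans hu.2⟩
    linarith
  obtain ⟨hei, hele⟩ := integral_exp_le (lam := 2 * M) (by positivity) hT hli ht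
  have hdl : ∀ᵐ s : ℝ, s ∈ Icc T0 T →
      d s ≤ c * (l s * Real.exp (2 * M * ∫ r in T0..s, l r)) := by
    filter_upwards [hdle] with s h1 hs
    refine (h1 hs).trans ?_
    set E := Real.exp (2 * M * ∫ r in T0..s, l r) with hE
    have h2 : ∫ r in T0..s, ψ r ≤ (T - T0) * (c * E) := by
      have h3 : ∫ r in T0..s, ψ r ≤ ∫ r in T0..s, c * E := by
        refine intervalIntegral.integral_mono_on hs.1 ?_ intervalIntegrable_const ?_
        · refine ContinuousOn.intervalIntegrable ?_
          rw [uIcc_of_le hs.1]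
          exact hψc.mono (Icc_subset_Icc_right hs.2)
        · intro r hr
          have hr' : r ∈ Icc T0 T := ⟨hr.1, hr.2.trans hs.2⟩
          refine (hψ r hr').trans (mul_le_mul_of_nonneg_left ?_ hc)
          refine Real.exp_le_exp.2 (mul_le_mul_of_nonneg_left (hmono r hr' s hs hr.2) (by positivity))
      rw [intervalIntegral.integral_const, smul_eq_mul] at h3
      refine h3.trans (mul_le_mul_of_nonneg_right (by linarith [hs.2]) (by positivity))
    have h4 := mul_le_mul_of_nonneg_left (hψ s hs) (hL1n s hs)
    have h5 := mul_le_mul_of_nonneg_left h2 (hL2n s hs)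
    calc _ ≤ L1 s * (c * E) + L2 s * ((T - T0) * (c * E)) := add_le_add h4 h5
      _ = c * (l s * E) := by simp only [hl]; ring
  have h6 : ∫ s in T0..t, d s ≤ ∫ s in T0..t, c * (l s * Real.exp (2 * M * ∫ r in T0..s, l r)) := by
    refine integral_mono_ae' ht.1 (ii_mono hd hT0 ht) (hei.const_mul c) ?_
    filter_upwards [hdl] with s h hs using h ⟨hs.1, hs.2.trans ht.2⟩
  rw [intervalIntegral.integral_const_mul] at h6
  have h7 := mul_le_mul_of_nonneg_left hele hc
  calc φ t ≤ M * ∫ s in T0..t, d s := hφ t ht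
    _ ≤ M * (c * (Real.exp (2 * M * ∫ r in T0..t, l r) / (2 * M))) :=
      mul_le_mul_of_nonneg_left (h6.trans h7) hM.le
    _ = _ := by field_simp

end Picard

section MainArgument
open Filter Topology
variable {n : ℕ}

/-- Solutions of the sweeping process with a prescribed perturbation. -/
structure IsSw (C : ℝ → Set (EuclideanSpace ℝ (Fin n))) (T0 T : ℝ) (x0 : EuclideanSpace ℝ (Fin n))
    (h : ℝ → EuclideanSpace ℝ (Fin n)) (A : ℝ → ℝ) (x x' : ℝ → EuclideanSpace ℝ (Fin n)) : Prop where
  initial : x T0 = x0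
  int : IntervalIntegrable x' volume T0 T
  eq : ∀ t ∈ Icc T0 T, x t = x T0 + ∫ s in T0..t, x' s
  mem : ∀ t ∈ Icc T0 T, x t ∈ C t
  ineq : ∀ᵐ t : ℝ, t ∈ Icc T0 T → ∀ y ∈ C t, ⟪-x' t - h t, y - x t⟫ ≤ A t * ‖y - x t‖ ^ 2

variable {C : ℝ → Set (EuclideanSpace ℝ (Fin n))} {T0 T : ℝ} {x0 : EuclideanSpace ℝ (Fin n)}
    {h : ℝ → EuclideanSpace ℝ (Fin n)} {A : ℝ → ℝ} {x x' : ℝ → EuclideanSpace ℝ (Fin n)}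

lemma IsSw.cont (hx : IsSw C T0 T x0 h A x x') (hT : T0 ≤ T) : ContinuousOn x (Icc T0 T) := by
  have := (ac_of_integral hT hx.int hx.eq).continuousOn
  rwa [uIcc_of_le hT] at this

lemma mem_cup {t : ℝ} (ht : t ∈ Icc T0 T) {z : EuclideanSpace ℝ (Fin n)} (hz : z ∈ C t) :
    z ∈ ⋃ s ∈ Icc T0 T, C s := mem_biUnion ht hz

variable {f1 : ℝ → EuclideanSpace ℝ (Fin n) → EuclideanSpace ℝ (Fin n)}
    {f2 : ℝ → ℝ → EuclideanSpace ℝ (Fin n) → EuclideanSpace ℝ (Fin n)}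
    {β1 : ℝ → ℝ} {β2 : ℝ → ℝ → ℝ}

lemma sw_contract (P : PertHyp (⋃ s ∈ Icc T0 T, C s) T0 T f1 f2 β1 β2) (hT : T0 ≤ T)
    {x y u u' v v' : ℝ → EuclideanSpace ℝ (Fin n)} {A B : ℝ → ℝ} {M c η : ℝ}
    (hx : ContinuousOn x (Icc T0 T)) (hxC : ∀ t ∈ Icc T0 T, x t ∈ C t)
    (hy : ContinuousOn y (Icc T0 T)) (hyC : ∀ t ∈ Icc T0 T, y t ∈ C t)
    (hxη : ∀ t ∈ Icc T0 T, ‖x t‖ ≤ η) (hyη : ∀ t ∈ Icc T0 T, ‖y t‖ ≤ η)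
    (hu : IsSw C T0 T x0 (pert T0 f1 f2 x) A u u') (hv : IsSw C T0 T x0 (pert T0 f1 f2 y) B v v')
    (hA : IntervalIntegrable A volume T0 T) (hB : IntervalIntegrable B volume T0 T)
    (hAnn : ∀ t ∈ Icc T0 T, 0 ≤ A t) (hBnn : ∀ t ∈ Icc T0 T, 0 ≤ B t)
    (hM : M = Real.exp (∫ s in T0..T, (A s + B s)))
    (hc : 0 ≤ c) {L1 L2 : ℝ → ℝ}
    (hL1i : IntervalIntegrable L1 volume T0 T) (hL1n : ∀ t ∈ Icc T0 T, 0 ≤ L1 t)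
    (hL2i : IntervalIntegrable L2 volume T0 T) (hL2n : ∀ t ∈ Icc T0 T, 0 ≤ L2 t)
    (hL1 : ∀ t ∈ Icc T0 T, ∀ x ∈ Metric.closedBall (0 : EuclideanSpace ℝ (Fin n)) η,
        ∀ y ∈ Metric.closedBall (0 : EuclideanSpace ℝ (Fin n)) η, ‖f1 t x - f1 t y‖ ≤ L1 t * ‖x - y‖)
    (hL2 : ∀ t ∈ Icc T0 T, ∀ s ∈ Icc T0 t, ∀ x ∈ Metric.closedBall (0 : EuclideanSpace ℝ (Fin n)) η,
        ∀ y ∈ Metric.closedBall (0 : EuclideanSpace ℝ (Fin n)) η, ‖f2 t s x - f2 t s y‖ ≤ L2 t * ‖x - y‖)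
    (hxy : ∀ t ∈ Icc T0 T, ‖x t - y t‖ ≤
      c * Real.exp (2 * M * ∫ s in T0..t, (L1 s + (T - T0) * L2 s))) :
    ∀ t ∈ Icc T0 T, ‖u t - v t‖ ≤
      c / 2 * Real.exp (2 * M * ∫ s in T0..t, (L1 s + (T - T0) * L2 s)) := by
  have hxD : ∀ t ∈ Icc T0 T, x t ∈ ⋃ s ∈ Icc T0 T, C s := fun t ht => mem_cup ht (hxC t ht)
  have hyD : ∀ t ∈ Icc T0 T, y t ∈ ⋃ s ∈ Icc T0 T, C s := fun t ht => mem_cup ht (hyC t ht)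
  have hpx := P.pert_int hT hx hxD
  have hpy := P.pert_int hT hy hyD
  refine picard_step hT (by rw [hM]; positivity) hc hL1i hL1n hL2i hL2n (hx.sub hy).norm hxy
    (d := fun s => ‖pert T0 f1 f2 x s - pert T0 f1 f2 y s‖) (hpx.sub hpy).norm
    (P.pert_diff hT hx hxD hy hyD hxη hyη hL1 hL2) ?_
  rw [hM]
  refine sweeping_comparison hT hu.int hu.eq hv.int hv.eq (hu.initial.trans hv.initial.symm)
    hpx hpy hA hB hAnn hBnn ?_ ?_
  · filter_upwards [hu.ineq] with t h1 ht using h1 ht _ (hv.mem t ht)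
  · filter_upwards [hv.ineq] with t h1 ht using h1 ht _ (hu.mem t ht)

lemma lam_nonneg {L1 L2 : ℝ → ℝ} (hL1n : ∀ t ∈ Icc T0 T, 0 ≤ L1 t)
    (hL2n : ∀ t ∈ Icc T0 T, 0 ≤ L2 t) {t : ℝ} (ht : t ∈ Icc T0 T) :
    0 ≤ ∫ s in T0..t, (L1 s + (T - T0) * L2 s) := by
  refine intervalIntegral.integral_nonneg ht.1 fun s hs => ?_
  have hs' : s ∈ Icc T0 T := ⟨hs.1, hs.2.trans ht.2⟩
  have : 0 ≤ T - T0 := by linarith [ht.1, ht.2]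
  have := hL1n s hs'
  have := hL2n s hs'
  positivity

/-- Uniqueness for the integro-differential sweeping process. -/
lemma sw_unique (P : PertHyp (⋃ s ∈ Icc T0 T, C s) T0 T f1 f2 β1 β2) (hT : T0 ≤ T)
    {u u' v v' : ℝ → EuclideanSpace ℝ (Fin n)} {A B : ℝ → ℝ}
    (hu : IsSw C T0 T x0 (pert T0 f1 f2 u) A u u') (hv : IsSw C T0 T x0 (pert T0 f1 f2 v) B v v')
    (hA : IntervalIntegrable A volume T0 T) (hB : IntervalIntegrable B volume T0 T)
    (hAnn : ∀ t ∈ Icc T0 T, 0 ≤ A t) (hBnn : ∀ t ∈ Icc T0 T, 0 ≤ B t) :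
    ∀ t ∈ Icc T0 T, u t = v t := by
  obtain ⟨R1, hR1⟩ := (isCompact_Icc (a := T0) (b := T)).exists_bound_of_continuousOn (hu.cont hT)
  obtain ⟨R2, hR2⟩ := (isCompact_Icc (a := T0) (b := T)).exists_bound_of_continuousOn (hv.cont hT)
  set η := |R1| + |R2| + 1 with hη
  have h1 : ∀ t ∈ Icc T0 T, ‖u t‖ ≤ η := fun t ht => by
    linarith [hR1 t ht, le_abs_self R1, abs_nonneg R2]
  have h2 : ∀ t ∈ Icc T0 T, ‖v t‖ ≤ η := fun t ht => by
    linarith [hR2 t ht, le_abs_self R2, abs_nonneg R1]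
  have hη0 : 0 < η := by positivity
  obtain ⟨L1, hL1i, hL1n, hL1⟩ := P.l1 η hη0
  obtain ⟨L2, hL2i, hL2n, hL2⟩ := P.l2 η hη0
  set M := Real.exp (∫ s in T0..T, (A s + B s)) with hM
  have hM0 : 0 < M := Real.exp_pos _
  have key : ∀ k : ℕ, ∀ t ∈ Icc T0 T, ‖u t - v t‖ ≤
      2 * η / 2 ^ k * Real.exp (2 * M * ∫ s in T0..t, (L1 s + (T - T0) * L2 s)) := by
    intro k
    induction k with
    | zero =>
      intro t ht
      have h3 : 1 ≤ Real.exp (2 * M * ∫ s in T0..t, (L1 s + (T - T0) * L2 s)) :=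
        Real.one_le_exp (mul_nonneg (by positivity) (lam_nonneg hL1n hL2n ht))
      have h4 := norm_sub_le (u t) (v t)
      have h5 := h1 t ht
      have h6 := h2 t ht
      rw [pow_zero, div_one]
      nlinarith
    | succ k ih =>
      have := sw_contract P hT (hu.cont hT) hu.mem (hv.cont hT) hv.mem h1 h2 hu hv hA hB hAnn hBnn
        hM (by positivity) hL1i hL1n hL2i hL2n hL1 hL2 ih
      intro t ht
      refine (this t ht).trans (le_of_eq ?_)
      rw [pow_succ]; ring
  intro t ht
  rw [← sub_eq_zero, ← norm_le_zero_iff]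
  have hlim : Tendsto (fun k : ℕ => 2 * η / 2 ^ k *
      Real.exp (2 * M * ∫ s in T0..t, (L1 s + (T - T0) * L2 s))) atTop (𝓝 0) := by
    have h3 := (tendsto_const_nhds (x := 2 * η)).div_atTop
      (tendsto_pow_atTop_atTop_of_one_lt (one_lt_two (α := ℝ)))
    simpa using h3.mul_const (Real.exp (2 * M * ∫ s in T0..t, (L1 s + (T - T0) * L2 s)))
  exact ge_of_tendsto' hlim fun k => key k t ht

/-- One step of the iteration, with the a priori bound. -/
lemma sw_step {w b : ℝ → ℝ} {r K a : ℝ} (hC : PSweepHyp C T0 T w r K) (hT : T0 ≤ T)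
    (hx0 : x0 ∈ C T0) (hb : IntervalIntegrable b volume T0 T) (hbn : ∀ t ∈ Icc T0 T, 0 ≤ b t)
    (ha : a = 2 * (1 + ‖x0‖ + ∫ s in T0..T, w s))
    (hh : IntervalIntegrable h volume T0 T)
    (hhb : ∀ᵐ t : ℝ, t ∈ Icc T0 T → ‖h t‖ ≤ b t * (a * Real.exp (4 * ∫ s in T0..t, b s))) :
    ∃ u u' : ℝ → EuclideanSpace ℝ (Fin n),
      (∀ t ∈ Icc T0 T, ‖u t‖ ≤ a * Real.exp (4 * ∫ s in T0..t, b s) - 1) ∧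
      IsSw C T0 T x0 h (fun t => K * (w t + b t * (a * Real.exp (4 * ∫ s in T0..T, b s)))) u u' := by
  have hT0 : T0 ∈ Icc T0 T := ⟨le_rfl, hT⟩
  have hTT : T ∈ Icc T0 T := ⟨hT, le_rfl⟩
  have hbmono : ∀ s ∈ Icc T0 T, ∀ u ∈ Icc T0 T, s ≤ u → ∫ r in T0..s, b r ≤ ∫ r in T0..u, b r := by
    intro s hs u hu hsu
    have h1 := intervalIntegral.integral_add_adjacent_intervals (ii_mono hb hT0 hs)
      (ii_mono hb hs hu)
    have h2 : 0 ≤ ∫ r in s..u, b r := intervalIntegral.integral_nonneg hsu fun r hr =>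
      hbn r ⟨hs.1.trans hr.1, hr.2.trans hu.2⟩
    linarith
  have hW : 0 ≤ ∫ s in T0..T, w s := intervalIntegral.integral_nonneg hT hC.wnn
  have ha0 : 0 ≤ a := by rw [ha]; positivity
  obtain ⟨u, u', hu0, hui, hue, hum, hua⟩ := exists_psweep hC hT hx0 hh
  refine ⟨u, u', ?_, hu0, hui, hue, hum, ?_⟩
  · intro t ht
    obtain ⟨hei, hele⟩ := integral_exp_le (lam := 4) (by norm_num) hT hb ht
    set E : ℝ → ℝ := fun t => Real.exp (4 * ∫ s in T0..t, b s) with hE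
    have hE1 : 1 ≤ E t := Real.one_le_exp (mul_nonneg (by norm_num)
      (intervalIntegral.integral_nonneg ht.1 fun s hs => hbn s ⟨hs.1, hs.2.trans ht.2⟩))
    have hwt := ii_mono hC.wint hT0 ht
    have hrhs : IntervalIntegrable (fun s => w s + 2 * a * (b s * E s)) volume T0 t :=
      hwt.add (hei.const_mul _)
    have h1 : ∫ s in T0..t, ‖u' s‖ ≤ ∫ s in T0..t, (w s + 2 * a * (b s * E s)) := by
      refine integral_mono_ae' ht.1 (ii_mono hui hT0 ht).norm hrhs ?_
      filter_upwards [hua, hhb] with s h1 h2 hs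
      have hs' : s ∈ Icc T0 T := ⟨hs.1, hs.2.trans ht.2⟩
      have h3 := (h1 hs').1
      have h4 := h2 hs'
      have h5 : ‖u' s‖ ≤ ‖u' s + h s‖ + ‖h s‖ := by
        simpa using norm_sub_le (u' s + h s) (h s)
      simp only [hE]
      linarith
    rw [intervalIntegral.integral_add hwt (hei.const_mul _), intervalIntegral.integral_const_mul] at h1
    have hWt : ∫ s in T0..t, w s ≤ ∫ s in T0..T, w s := by
      have e := intervalIntegral.integral_add_adjacent_intervals hwt (ii_mono hC.wint ht hTT)
      have : 0 ≤ ∫ s in t..T, w s := intervalIntegral.integral_nonneg ht.2 fun s hs =>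
        hC.wnn s ⟨ht.1.trans hs.1, hs.2⟩
      linarith
    have h6 : ‖u t‖ ≤ ‖x0‖ + ∫ s in T0..t, ‖u' s‖ := by
      rw [hue t ht, hu0]
      exact (norm_add_le _ _).trans
        (add_le_add_right (intervalIntegral.norm_integral_le_integral_norm ht.1) _)
    have h7 := mul_le_mul_of_nonneg_left hele (by positivity : 0 ≤ 2 * a)
    have h8 : a ≤ a * E t := le_mul_of_one_le_right ha0 hE1
    have h9 : 2 * a * (E t / 4) = a * E t / 2 := by ring
    change _ ≤ a * E t - 1
    change 2 * a * _ ≤ 2 * a * (E t / 4) at h7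
    rw [h9] at h7
    linarith
  · filter_upwards [hua, hhb] with t h1 h2 ht y hy
    refine ((h1 ht).2 y hy).trans (mul_le_mul_of_nonneg_right ?_ (by positivity))
    refine mul_le_mul_of_nonneg_left (add_le_add_right ((h2 ht).trans ?_) _) hC.Knn
    refine mul_le_mul_of_nonneg_left (mul_le_mul_of_nonneg_left ?_ ha0) (hbn t ht)
    exact Real.exp_le_exp.2 (by linarith [hbmono t ht T hTT ht.2])

end MainArgument

section Existence
open Filter Topology
variable {n : ℕ} {C : ℝ → Set (EuclideanSpace ℝ (Fin n))} {T0 T : ℝ} {x0 : EuclideanSpace ℝ (Fin n)}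
    {f1 : ℝ → EuclideanSpace ℝ (Fin n) → EuclideanSpace ℝ (Fin n)}
    {f2 : ℝ → ℝ → EuclideanSpace ℝ (Fin n) → EuclideanSpace ℝ (Fin n)}
    {β1 : ℝ → ℝ} {β2 : ℝ → ℝ → ℝ}

lemma sw_exists {w : ℝ → ℝ} {r K : ℝ} (P : PertHyp (⋃ s ∈ Icc T0 T, C s) T0 T f1 f2 β1 β2)
    (hC : PSweepHyp C T0 T w r K) (hT : T0 ≤ T) (hx0 : x0 ∈ C T0) :
    ∃ (x x' : ℝ → EuclideanSpace ℝ (Fin n)) (A : ℝ → ℝ),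
      IsSw C T0 T x0 (pert T0 f1 f2 x) A x x' := by
  have hT0 : T0 ∈ Icc T0 T := ⟨le_rfl, hT⟩
  have hTT : T ∈ Icc T0 T := ⟨hT, le_rfl⟩
  set b : ℝ → ℝ := fun t => β1 t + ∫ s in T0..t, β2 t s with hbdef
  have hb : IntervalIntegrable b volume T0 T := P.i1.add (P.b2_int hT)
  have hbn : ∀ t ∈ Icc T0 T, 0 ≤ b t := fun t ht => add_nonneg (P.n1 t ht) (P.b2_nonneg ht)
  obtain ⟨a, ha⟩ : ∃ a, a = 2 * (1 + ‖x0‖ + ∫ s in T0..T, w s) := ⟨_, rfl⟩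
  have hW : 0 ≤ ∫ s in T0..T, w s := intervalIntegral.integral_nonneg hT hC.wnn
  have ha0 : 0 < a := by rw [ha]; positivity
  have hbmono : ∀ s ∈ Icc T0 T, ∀ u ∈ Icc T0 T, s ≤ u → ∫ r in T0..s, b r ≤ ∫ r in T0..u, b r := by
    intro s hs u hu hsu
    have h1 := intervalIntegral.integral_add_adjacent_intervals (ii_mono hb hT0 hs)
      (ii_mono hb hs hu)
    have h2 : 0 ≤ ∫ r in s..u, b r := intervalIntegral.integral_nonneg hsu fun r hr =>
      hbn r ⟨hs.1.trans hr.1, hr.2.trans hu.2⟩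
    linarith
  set R : ℝ → ℝ := fun t => a * Real.exp (4 * ∫ s in T0..t, b s) - 1 with hR
  have hRmono : ∀ s ∈ Icc T0 T, ∀ u ∈ Icc T0 T, s ≤ u → R s ≤ R u := by
    intro s hs u hu hsu
    exact sub_le_sub_right (mul_le_mul_of_nonneg_left
      (Real.exp_le_exp.2 (by linarith [hbmono s hs u hu hsu])) ha0.le) _
  set A : ℝ → ℝ := fun t => K * (w t + b t * (a * Real.exp (4 * ∫ s in T0..T, b s))) with hA
  have hAi : IntervalIntegrable A volume T0 T := (hC.wint.add (hb.mul_const _)).const_mul _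
  have hAn : ∀ t ∈ Icc T0 T, 0 ≤ A t := fun t ht =>
    mul_nonneg hC.Knn (add_nonneg (hC.wnn t ht) (mul_nonneg (hbn t ht) (by positivity)))
  let X : (ℝ → EuclideanSpace ℝ (Fin n)) → Prop := fun x =>
    ContinuousOn x (Icc T0 T) ∧ (∀ t ∈ Icc T0 T, x t ∈ C t) ∧ ∀ t ∈ Icc T0 T, ‖x t‖ ≤ R t
  have step : ∀ x : {x // X x}, ∃ u : {x // X x}, ∃ u' : ℝ → EuclideanSpace ℝ (Fin n),
      IsSw C T0 T x0 (pert T0 f1 f2 x) A u u' := by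
    rintro ⟨x, hxc, hxC, hxR⟩
    have hxD : ∀ t ∈ Icc T0 T, x t ∈ ⋃ s ∈ Icc T0 T, C s := fun t ht => mem_cup ht (hxC t ht)
    have hh : ∀ᵐ t : ℝ, t ∈ Icc T0 T →
        ‖pert T0 f1 f2 x t‖ ≤ b t * (a * Real.exp (4 * ∫ s in T0..t, b s)) := by
      filter_upwards [P.pert_bound hxD] with t h1 ht
      have h2 := h1 ht (R t) fun s hs => (hxR s ⟨hs.1, hs.2.trans ht.2⟩).trans
        (hRmono s ⟨hs.1, hs.2.trans ht.2⟩ t ht hs.2)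
      have e : 1 + R t = a * Real.exp (4 * ∫ s in T0..t, b s) := by simp only [hR]; ring
      rwa [e] at h2
    obtain ⟨u, u', huR, hu⟩ := sw_step hC hT hx0 hb hbn ha (P.pert_int hT hxc hxD) hh
    exact ⟨⟨u, hu.cont hT, hu.mem, huR⟩, u', hu⟩
  have start : ∃ x, X x := by
    obtain ⟨u, u', huR, hu⟩ := sw_step (h := fun _ => 0) hC hT hx0 hb hbn ha
      intervalIntegrable_const (Eventually.of_forall fun t ht => by
        rw [norm_zero]; exact mul_nonneg (hbn t ht) (by positivity))
    exact ⟨u, hu.cont hT, hu.mem, huR⟩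
  obtain ⟨xi, hxi⟩ := start
  choose Φ Φ' hΦ using step
  let q : ℕ → {x // X x} := fun k => Φ^[k] ⟨xi, hxi⟩
  have hq : ∀ k, q (k + 1) = Φ (q k) := fun k => Function.iterate_succ_apply' _ _ _
  set η := |R T| + 1 with hη
  have hη0 : 0 < η := by positivity
  have hXη : ∀ x : {x // X x}, ∀ t ∈ Icc T0 T, ‖x.1 t‖ ≤ η := fun x t ht => by
    linarith [x.2.2.2 t ht, hRmono t ht T hTT ht.2, le_abs_self (R T)]
  obtain ⟨L1, hL1i, hL1n, hL1⟩ := P.l1 η hη0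
  obtain ⟨L2, hL2i, hL2n, hL2⟩ := P.l2 η hη0
  set M := Real.exp (∫ s in T0..T, (A s + A s)) with hM
  have hM0 : 0 < M := Real.exp_pos _
  set E : ℝ → ℝ := fun t => Real.exp (2 * M * ∫ s in T0..t, (L1 s + (T - T0) * L2 s)) with hE
  have hE1 : ∀ t ∈ Icc T0 T, 1 ≤ E t := fun t ht =>
    Real.one_le_exp (mul_nonneg (by positivity) (lam_nonneg hL1n hL2n ht))
  have hli : IntervalIntegrable (fun s => L1 s + (T - T0) * L2 s) volume T0 T :=
    hL1i.add (hL2i.const_mul _)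
  have hET : ∀ t ∈ Icc T0 T, E t ≤ E T := by
    intro t ht
    refine Real.exp_le_exp.2 (mul_le_mul_of_nonneg_left ?_ (by positivity))
    have h1 := intervalIntegral.integral_add_adjacent_intervals (ii_mono hli hT0 ht)
      (ii_mono hli ht hTT)
    have h2 : 0 ≤ ∫ s in t..T, (L1 s + (T - T0) * L2 s) :=
      intervalIntegral.integral_nonneg ht.2 fun s hs => by
        have hs' : s ∈ Icc T0 T := ⟨ht.1.trans hs.1, hs.2⟩
        exact add_nonneg (hL1n s hs') (mul_nonneg (by linarith) (hL2n s hs'))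
    linarith
  have contr : ∀ x y : {x // X x}, ∀ c : ℝ, 0 ≤ c →
      (∀ t ∈ Icc T0 T, ‖x.1 t - y.1 t‖ ≤ c * E t) →
      ∀ t ∈ Icc T0 T, ‖(Φ x).1 t - (Φ y).1 t‖ ≤ c / 2 * E t := fun x y c hc hxy =>
    sw_contract P hT x.2.1 x.2.2.1 y.2.1 y.2.2.1 (hXη x) (hXη y) (hΦ x) (hΦ y) hAi hAi hAn hAn hM hc
      hL1i hL1n hL2i hL2n hL1 hL2 hxy
  have key : ∀ k : ℕ, ∀ t ∈ Icc T0 T, ‖(q (k + 1)).1 t - (q k).1 t‖ ≤ 2 * η / 2 ^ k * E t := by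
    intro k
    induction k with
    | zero =>
      intro t ht
      have h4 := norm_sub_le ((q (0 + 1)).1 t) ((q 0).1 t)
      have h5 := hXη (q (0 + 1)) t ht
      have h6 := hXη (q 0) t ht
      have h7 := hE1 t ht
      rw [pow_zero, div_one]
      nlinarith
    | succ k ih =>
      intro t ht
      have := contr (q (k + 1)) (q k) _ (by positivity) ih t ht
      rw [← hq (k + 1), ← hq k] at this
      refine this.trans (le_of_eq ?_)
      rw [pow_succ]; ring
  set G := 4 * η * E T with hG
  have hG0 : 0 ≤ G := by have := Real.exp_pos (2 * M * ∫ s in T0..T, (L1 s + (T - T0) * L2 s)); positivity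
  have hdist : ∀ t ∈ Icc T0 T, ∀ k, dist ((q k).1 t) ((q (k + 1)).1 t) ≤ G / 2 / 2 ^ k := by
    intro t ht k
    rw [dist_comm, dist_eq_norm]
    refine (key k t ht).trans ((mul_le_mul_of_nonneg_left (hET t ht) (by positivity)).trans
      (le_of_eq ?_))
    rw [hG]; ring
  have hlim : ∀ t : ℝ, ∃ z : EuclideanSpace ℝ (Fin n), t ∈ Icc T0 T →
      Tendsto (fun k => (q k).1 t) atTop (𝓝 z) := by
    intro t
    by_cases ht : t ∈ Icc T0 T
    · obtain ⟨z, hz⟩ := cauchySeq_tendsto_of_complete (cauchySeq_of_le_geometric_two (hdist t ht))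
      exact ⟨z, fun _ => hz⟩
    · exact ⟨0, fun h => absurd h ht⟩
  choose x hx using hlim
  have hxd : ∀ t ∈ Icc T0 T, ∀ k, dist ((q k).1 t) (x t) ≤ G / 2 ^ k := fun t ht k =>
    dist_le_of_le_geometric_two_of_tendsto (hdist t ht) (hx t ht) k
  have hG2 : Tendsto (fun k : ℕ => G / 2 ^ k) atTop (𝓝 0) :=
    (tendsto_const_nhds (x := G)).div_atTop
      (tendsto_pow_atTop_atTop_of_one_lt (one_lt_two (α := ℝ)))
  have hunif : TendstoUniformlyOn (fun k => (q k).1) x atTop (Icc T0 T) := by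
    rw [Metric.tendstoUniformlyOn_iff]
    intro ε hε
    filter_upwards [hG2.eventually_lt_const hε] with k hk t ht
    rw [dist_comm]
    exact (hxd t ht k).trans_lt hk
  have hxX : X x := by
    refine ⟨hunif.continuousOn (Frequently.of_forall fun k => (q k).2.1), ?_, ?_⟩
    · intro t ht
      exact (hC.closed t ht).mem_of_tendsto (hx t ht) (Eventually.of_forall fun k => (q k).2.2.1 t ht)
    · intro t ht
      exact le_of_tendsto (hx t ht).norm (Eventually.of_forall fun k => (q k).2.2.2 t ht)
  have hfix : ∀ t ∈ Icc T0 T, (Φ ⟨x, hxX⟩).1 t = x t := by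
    intro t ht
    have h1 : ∀ k, dist ((q (k + 1)).1 t) ((Φ ⟨x, hxX⟩).1 t) ≤ G / 2 ^ k * (E t / 2) := by
      intro k
      have := contr (q k) ⟨x, hxX⟩ (G / 2 ^ k) (by positivity) (fun s hs => by
        rw [← dist_eq_norm]
        exact (hxd s hs k).trans (le_mul_of_one_le_right (by positivity) (hE1 s hs))) t ht
      rw [dist_eq_norm, hq k]
      exact this.trans (le_of_eq (by ring))
    have h2 : Tendsto (fun k => (q (k + 1)).1 t) atTop (𝓝 ((Φ ⟨x, hxX⟩).1 t)) := by
      rw [tendsto_iff_dist_tendsto_zero]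
      refine squeeze_zero (fun k => dist_nonneg) h1 ?_
      simpa using hG2.mul_const (E t / 2)
    exact tendsto_nhds_unique h2 ((tendsto_add_atTop_iff_nat 1).2 (hx t ht))
  refine ⟨(Φ ⟨x, hxX⟩).1, Φ' ⟨x, hxX⟩, A, ?_⟩
  have hs := hΦ ⟨x, hxX⟩
  refine ⟨hs.initial, hs.int, hs.eq, hs.mem, ?_⟩
  filter_upwards [hs.ineq] with t h1 ht
  rw [pert_congr hfix ht]
  exact h1 ht

end Existence

/-- Theorem 5.4: existence and uniqueness for the nonlinear integro-differential
complementarity system. -/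
theorem nidcs_existence_uniqueness
    (T0 T : ℝ) (hT : T0 < T) (n m : ℕ)
    (g : Fin m → ℝ → EuclideanSpace ℝ (Fin n) → ℝ)
    (C : ℝ → Set (EuclideanSpace ℝ (Fin n)))
    (hCdef : ∀ t ∈ Icc T0 T, C t = {x | ∀ k : Fin m, g k t x ≤ 0})
    (hCne : ∀ t ∈ Icc T0 T, (C t).Nonempty)
    (hCcl : ∀ t ∈ Icc T0 T, IsClosed (C t))
    (ρ : ℝ≥0∞) (hρ : 0 < ρ)
    (hdiff : ∀ t ∈ Icc T0 T, ∀ k : Fin m,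
      ContDiffOn ℝ 1 (g k t) {y | ENNReal.ofReal (Metric.infDist y (C t)) < ρ})
    (γ : ℝ) (hγ : 0 < γ)
    (hhypo : ∀ t ∈ Icc T0 T, ∀ k : Fin m,
      ∀ x ∈ {y : EuclideanSpace ℝ (Fin n) | ENNReal.ofReal (Metric.infDist y (C t)) < ρ},
      ∀ z ∈ {y : EuclideanSpace ℝ (Fin n) | ENNReal.ofReal (Metric.infDist y (C t)) < ρ},
        ⟪gradient (g k t) x - gradient (g k t) z, x - z⟫ ≥ -γ * ‖x - z‖ ^ 2)
    (δ : ℝ) (hδ : 0 < δ)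
    (hslater : ∀ t ∈ Icc T0 T, ∀ x ∈ frontier (C t),
      ∃ v ∈ Metric.closedBall (0 : EuclideanSpace ℝ (Fin n)) 1,
        ∀ k : Fin m, ⟪gradient (g k t) x, v⟫ ≤ -δ)
    (r : ℝ≥0∞) (hrdef : r = min ρ (ENNReal.ofReal (δ / γ)))
    (w w' : ℝ → ℝ)
    (hwint : IntervalIntegrable w' volume T0 T)
    (hwAC : ∀ t ∈ Icc T0 T, w t = w T0 + ∫ s in T0..t, w' s)
    (δ' : ℝ) (hδ' : 0 < δ')
    (y : EuclideanSpace ℝ (Fin n)) (hy : ‖y‖ = 1)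
    (hmono : ∀ i : Fin m, ∀ s ∈ Icc T0 T, ∀ t ∈ Icc T0 T,
      ∀ x : EuclideanSpace ℝ (Fin n), ENNReal.ofReal (Metric.infDist x (C s)) < r →
        g i t x ≤ g i s x + |w t - w s|)
    (hgrad : ∀ i : Fin m, ∀ t ∈ Icc T0 T,
      ∀ x : EuclideanSpace ℝ (Fin n), ENNReal.ofReal (Metric.infDist x (C t)) < r →
        ⟪gradient (g i t) x, y⟫ ≤ -δ')
    (f1 : ℝ → EuclideanSpace ℝ (Fin n) → EuclideanSpace ℝ (Fin n))
    (hf1meas : ∀ x : EuclideanSpace ℝ (Fin n), StronglyMeasurable fun t => f1 t x)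
    (β1 : ℝ → ℝ)
    (hβ1int : IntervalIntegrable β1 volume T0 T)
    (hβ1nn : ∀ t ∈ Icc T0 T, 0 ≤ β1 t)
    (hf1grow : ∀ t ∈ Icc T0 T, ∀ x ∈ ⋃ s ∈ Icc T0 T, C s, ‖f1 t x‖ ≤ β1 t * (1 + ‖x‖))
    (hf1lip : ∀ η : ℝ, 0 < η → ∃ L1 : ℝ → ℝ, IntervalIntegrable L1 volume T0 T ∧
      (∀ t ∈ Icc T0 T, 0 ≤ L1 t) ∧
      ∀ t ∈ Icc T0 T, ∀ x ∈ Metric.closedBall (0 : EuclideanSpace ℝ (Fin n)) η,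
        ∀ y ∈ Metric.closedBall (0 : EuclideanSpace ℝ (Fin n)) η, ‖f1 t x - f1 t y‖ ≤ L1 t * ‖x - y‖)
    (f2 : ℝ → ℝ → EuclideanSpace ℝ (Fin n) → EuclideanSpace ℝ (Fin n))
    (hf2meas : ∀ x : EuclideanSpace ℝ (Fin n), StronglyMeasurable fun p : ℝ × ℝ => f2 p.1 p.2 x)
    (β2 : ℝ → ℝ → ℝ)
    (hβ2int : IntegrableOn (fun p : ℝ × ℝ => β2 p.1 p.2)
      {p : ℝ × ℝ | p.1 ∈ Icc T0 T ∧ p.2 ∈ Icc T0 T ∧ p.2 ≤ p.1} volume)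
    (hβ2nn : ∀ t ∈ Icc T0 T, ∀ s ∈ Icc T0 t, 0 ≤ β2 t s)
    (hf2grow : ∀ t ∈ Icc T0 T, ∀ s ∈ Icc T0 t, ∀ x ∈ ⋃ u ∈ Icc T0 T, C u,
      ‖f2 t s x‖ ≤ β2 t s * (1 + ‖x‖))
    (hf2lip : ∀ η : ℝ, 0 < η → ∃ L2 : ℝ → ℝ, IntervalIntegrable L2 volume T0 T ∧
      (∀ t ∈ Icc T0 T, 0 ≤ L2 t) ∧
      ∀ t ∈ Icc T0 T, ∀ s ∈ Icc T0 t, ∀ x ∈ Metric.closedBall (0 : EuclideanSpace ℝ (Fin n)) η,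
        ∀ y ∈ Metric.closedBall (0 : EuclideanSpace ℝ (Fin n)) η, ‖f2 t s x - f2 t s y‖ ≤ L2 t * ‖x - y‖)
    (x0 : EuclideanSpace ℝ (Fin n)) (hx0 : ∀ k : Fin m, g k T0 x0 ≤ 0) :
    (∃ x x' : ℝ → EuclideanSpace ℝ (Fin n), x T0 = x0 ∧ IsNIDCSSol T0 T g f1 f2 x x') ∧
    (∀ x x' y y' : ℝ → EuclideanSpace ℝ (Fin n), x T0 = x0 → y T0 = x0 →
      IsNIDCSSol T0 T g f1 f2 x x' → IsNIDCSSol T0 T g f1 f2 y y' →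
      ∀ t ∈ Icc T0 T, x t = y t) := by
  have hTle : T0 ≤ T := hT.le
  have hT0 : T0 ∈ Icc T0 T := ⟨le_rfl, hTle⟩
  have hrpos : 0 < r := by
    rw [hrdef]; exact lt_min hρ (ENNReal.ofReal_pos.2 (div_pos hδ hγ))
  have hrtop : r ≠ ⊤ := by
    rw [hrdef]; exact ((min_le_right _ _).trans_lt ENNReal.ofReal_lt_top).ne
  have hrρ : r ≤ ρ := by rw [hrdef]; exact min_le_left _ _
  have hG : ∀ t ∈ Icc T0 T, ConHyp (fun k => g k t) (C t) r.toReal γ δ' y := fun t ht =>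
    conHyp_of (hCdef t ht) (hdiff t ht) hγ (hhypo t ht) hrpos hrtop hrρ hδ' hy
      (fun i => hgrad i t ht)
  have hS := psweep_of hCne hCcl hG hTle hwint hwAC (fun i s hs t ht x hx => hmono i s hs t ht x
    ((ENNReal.ofReal_lt_iff_lt_toReal Metric.infDist_nonneg hrtop).2 hx))
  have P : PertHyp (⋃ s ∈ Icc T0 T, C s) T0 T f1 f2 β1 β2 :=
    ⟨hf1meas, hβ1int, hβ1nn, hf1grow, hf1lip, hf2meas, hβ2int, hβ2nn, hf2grow, hf2lip⟩
  have hx0C : x0 ∈ C T0 := by rw [hCdef T0 hT0]; exact hx0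
  refine ⟨?_, ?_⟩
  · obtain ⟨x, x', A, hx⟩ := sw_exists P hS hTle hx0C
    refine ⟨x, x', hx.initial, hx.int, hx.eq, ?_, ?_⟩
    · intro t ht k
      have := hx.mem t ht
      rw [hCdef t ht] at this
      exact this k
    · have hz : ∀ t : ℝ, ∃ z : Fin m → ℝ, (∀ k, 0 ≤ z k) ∧
          ((t ∈ Icc T0 T ∧ ∀ p ∈ C t, ⟪-x' t - pert T0 f1 f2 x t, p - x t⟫ ≤ A t * ‖p - x t‖ ^ 2) →
            (∀ k, z k * g k t (x t) = 0) ∧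
            -x' t - pert T0 f1 f2 x t = ∑ k, z k • gradient (g k t) (x t)) := by
        intro t
        by_cases h : t ∈ Icc T0 T ∧
            ∀ p ∈ C t, ⟪-x' t - pert T0 f1 f2 x t, p - x t⟫ ≤ A t * ‖p - x t‖ ^ 2
        · obtain ⟨z, h1, h2, h3⟩ := (hG t h.1).kkt (hx.mem t h.1) h.2
          exact ⟨z, h1, fun _ => ⟨h2, h3⟩⟩
        · exact ⟨fun _ => 0, fun _ => le_rfl, fun h' => absurd h' h⟩
      choose z hz0 hz1 using hz
      refine ⟨z, fun t _ k => hz0 t k, ?_⟩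
      filter_upwards [hx.ineq] with t h1 ht
      obtain ⟨h2, h3⟩ := hz1 t ⟨ht, h1 ht⟩
      refine ⟨?_, h2⟩
      rw [← h3]
      unfold pert
      abel
  · have conv : ∀ x x' : ℝ → EuclideanSpace ℝ (Fin n), x T0 = x0 → IsNIDCSSol T0 T g f1 f2 x x' →
        IntervalIntegrable (fun t => (γ / δ' + 1 / r.toReal) * ‖-x' t - pert T0 f1 f2 x t‖)
          volume T0 T ∧
        IsSw C T0 T x0 (pert T0 f1 f2 x)
          (fun t => (γ / δ' + 1 / r.toReal) * ‖-x' t - pert T0 f1 f2 x t‖) x x' := by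
      intro x x' hxi hx
      obtain ⟨h1, h2, h3, z, hz, hae⟩ := hx
      have hmem : ∀ t ∈ Icc T0 T, x t ∈ C t := fun t ht => by
        rw [hCdef t ht]; exact h3 t ht
      have hSw : IsSw C T0 T x0 (pert T0 f1 f2 x)
          (fun t => (γ / δ' + 1 / r.toReal) * ‖-x' t - pert T0 f1 f2 x t‖) x x' := by
        refine ⟨hxi, h1, h2, hmem, ?_⟩
        filter_upwards [hae] with t h4 ht p hp
        obtain ⟨h5, h6⟩ := h4 ht
        have e : -x' t - pert T0 f1 f2 x t = ∑ k, z t k • gradient (g k t) (x t) := by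
          rw [h5]; unfold pert; abel
        rw [e]
        exact (hG t ht).proxreg (hmem t ht) (hz t ht) h6 hp
      refine ⟨?_, hSw⟩
      exact ((h1.neg.sub (P.pert_int hTle (hSw.cont hTle)
        fun t ht => mem_cup ht (hmem t ht))).norm).const_mul _
    intro x x' u u' hx hu hxs hus
    obtain ⟨hA, hx'⟩ := conv x x' hx hxs
    obtain ⟨hB, hu'⟩ := conv u u' hu hus
    have hK := hS.Knn
    exact sw_unique P hTle hx' hu' hA hB (fun t _ => mul_nonneg hK (norm_nonneg _))
      (fun t _ => mul_nonneg hK (norm_nonneg _))
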